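/- arXiv:2406.04154 — 2 statements merged into one kernel-verified Lean document; each statement's English description precedes it below -/
import Mathlib

section
/- For every integer r ≥ 3 there exist constants c(r) > 0 and C(r) > 0 such that for every m ≥ 5r² and every integer 0 ≤ f ≤ binom(m, r), every n-vertex r-graph (with n sufficiently large) that contains no (m,f)-subset contains a homogeneous set of size at least C(r) · (log_{(r-2)}(n))^{c(r)/m}. -/
/-- The `k`-times iterated base-2 logarithm: `iterLog 0 x = x`,
`iterLog (k+1) x = log₂ (iterLog k x)`. -/
noncomputable def iterLog : ℕ → ℝ → ℝ
  | 0, x => x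
  | k + 1, x => Real.logb 2 (iterLog k x)

/-- `S` is a clique in the `r`-graph with edge set `E`: every `r`-subset of `S` is an edge. -/
def IsRClique {n : ℕ} (r : ℕ) (E : Finset (Finset (Fin n))) (S : Finset (Fin n)) : Prop :=
  ∀ e : Finset (Fin n), e ⊆ S → e.card = r → e ∈ E

/-- `S` is an independent set in the `r`-graph with edge set `E`:
no `r`-subset of `S` is an edge. -/
def IsRIndep {n : ℕ} (r : ℕ) (E : Finset (Finset (Fin n))) (S : Finset (Fin n)) : Prop :=
  ∀ e : Finset (Fin n), e ⊆ S → e.card = r → e ∉ E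

/-- The `r`-graph with edge set `E` has an `(m,f)`-subset: a set of `m` vertices
inducing exactly `f` edges. -/
def HasMFSubset {n : ℕ} (E : Finset (Finset (Fin n))) (m f : ℕ) : Prop :=
  ∃ S : Finset (Fin n), S.card = m ∧ (E.filter (fun e => e ⊆ S)).card = f

/-- Multisets of forward degrees of the ordered graphs built by adding a first vertex joined to
nothing, a first vertex joined to everything, or a last vertex joined to everything. -/
inductive TailPattern : Multiset ℕ → Prop
  | nil : TailPattern 0
  | isolated {M : Multiset ℕ} : TailPattern M → TailPattern (0 ::ₘ M)
  | dominating {M : Multiset ℕ} : TailPattern M → TailPattern (M.card ::ₘ M)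
  | append {M : Multiset ℕ} : TailPattern M → TailPattern (0 ::ₘ M.map Nat.succ)

/-- `∑ c ∈ M, c.choose p`. -/
def chooseSum (p : ℕ) (M : Multiset ℕ) : ℕ := (M.map fun c => c.choose p).sum

theorem TailPattern.add_zeros {M : Multiset ℕ} (h : TailPattern M) (k : ℕ) :
    TailPattern (Multiset.replicate k 0 + M) := by
  induction k with
  | zero => simpa using h
  | succ k ih => simpa [Multiset.replicate_succ] using ih.isolated

theorem TailPattern.add_range (q : ℕ) :
    ∀ M : Multiset ℕ, (∀ c ∈ M, c ≤ q) → TailPattern (M + Multiset.range q) := by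
  induction q with
  | zero =>
    intro M hM
    have : M = Multiset.replicate M.card 0 :=
      Multiset.eq_replicate_card.2 fun c hc => Nat.le_zero.1 (hM c hc)
    rw [this]
    simpa using TailPattern.nil.add_zeros M.card
  | succ q ih =>
    intro M hM
    have hsplit : M = Multiset.replicate (M.count 0) 0 +
        ((M.filter (fun c => ¬ c = 0)).map Nat.pred).map Nat.succ := by
      conv_lhs => rw [← Multiset.filter_add_not (fun c => c = 0) M, Multiset.filter_eq']
      congr 1
      rw [Multiset.map_map]
      symm
      conv_rhs => rw [← Multiset.map_id (M.filter (fun c => ¬ c = 0))]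
      refine Multiset.map_congr rfl fun c hc => ?_
      have := (Multiset.mem_filter.1 hc).2
      exact Nat.succ_pred this
    have hrange : Multiset.range (q + 1) = 0 ::ₘ (Multiset.range q).map Nat.succ := by
      have := List.range_succ_eq_map (n := q)
      rw [← Multiset.coe_range, ← Multiset.coe_range, this]
      rfl
    have key := (ih ((M.filter (fun c => ¬ c = 0)).map Nat.pred) (by
      intro c hc
      obtain ⟨d, hd, rfl⟩ := Multiset.mem_map.1 hc
      have := hM d (Multiset.mem_filter.1 hd).1
      have : d.pred = d - 1 := rfl
      omega)).append.add_zeros (M.count 0)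
    rw [Multiset.map_add] at key
    rw [hrange]
    nth_rewrite 1 [hsplit]
    rw [add_assoc, Multiset.add_cons]
    exact key

theorem chooseSum_add (p : ℕ) (M N : Multiset ℕ) :
    chooseSum p (M + N) = chooseSum p M + chooseSum p N := by
  simp [chooseSum]

theorem chooseSum_cons (p a : ℕ) (M : Multiset ℕ) :
    chooseSum p (a ::ₘ M) = a.choose p + chooseSum p M := by
  simp [chooseSum]

theorem chooseSum_replicate (p k a : ℕ) :
    chooseSum p (Multiset.replicate k a) = k * a.choose p := by
  simp [chooseSum]

theorem chooseSum_range (p q : ℕ) : chooseSum p (Multiset.range q) = q.choose (p + 1) := by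
  induction q with
  | zero => simp [chooseSum]
  | succ q ih => rw [Multiset.range_succ, chooseSum_cons, ih, Nat.choose_succ_succ]

theorem choose_le_chooseSum {p c : ℕ} {M : Multiset ℕ} (hc : c ∈ M) :
    c.choose p ≤ chooseSum p M :=
  Multiset.single_le_sum (fun _ _ => Nat.zero_le _) _ (Multiset.mem_map_of_mem _ hc)

/-- Some tail pattern on `k` vertices has value `F`. -/
def Attains (p k F : ℕ) : Prop :=
  ∃ M, TailPattern M ∧ M.card = k ∧ chooseSum p M = F

/-- Every number below `X` is a sum of at most `s` binomial coefficients `c.choose p`. -/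
def Represents (p s X : ℕ) : Prop :=
  ∀ F < X, ∃ M : Multiset ℕ, M.card ≤ s ∧ chooseSum p M = F

theorem exists_choose_le_lt {p F b : ℕ} (hp : 0 < p) (hb : b.choose p ≤ F) :
    ∃ a, b ≤ a ∧ a.choose p ≤ F ∧ F < (a + 1).choose p := by
  have hex : ∃ a, F < (a + 1).choose p := by
    refine ⟨F + p, ?_⟩
    have h1 : F + 1 ≤ (F + p + 1).choose p := by
      have : (F + p + 1).choose (F + 1) = (F + p + 1).choose p := by
        rw [← Nat.choose_symm_of_eq_add]; omega
      rw [← this]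
      obtain ⟨p, rfl⟩ := Nat.exists_eq_succ_of_ne_zero hp.ne'
      calc F + 1 ≤ F + 2 := by omega
        _ = (F + 2).choose (F + 1) := by
            rw [Nat.choose_succ_self_right]
        _ ≤ _ := Nat.choose_le_choose _ (by omega)
    omega
  classical
  refine ⟨Nat.find hex, ?_, ?_, Nat.find_spec hex⟩
  · by_contra hlt
    have := (Nat.find_spec hex).trans_le (Nat.choose_le_choose p (show _ ≤ b by omega))
    omega
  · rcases hz : Nat.find hex with _ | a
    · exact (Nat.choose_le_choose p (Nat.zero_le b)).trans hb
    · exact not_lt.1 (Nat.find_min hex (by omega : a < Nat.find hex))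

theorem Represents.attains {p g q : ℕ} (hp : 0 < p) (h : Represents p g (q.choose p)) :
    ∀ F < (q + 1).choose (p + 1), Attains p (q + g) F := by
  intro F hF
  obtain ⟨a, -, ha, ha'⟩ := exists_choose_le_lt (p := p + 1) (F := F) (b := 0) (by omega) (by simp)
  have haq : a ≤ q := by
    by_contra hlt
    have := Nat.choose_le_choose (p + 1) (show q + 1 ≤ a by omega)
    omega
  rw [Nat.choose_succ_succ, Nat.succ_eq_add_one] at ha'
  have hrem : F - a.choose (p + 1) < a.choose p := by omega
  obtain ⟨M, hM, hsum⟩ := h _ (hrem.trans_le (Nat.choose_le_choose p haq))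
  have hle : ∀ c ∈ M, c ≤ a := by
    intro c hc
    by_contra hlt
    have h1 := choose_le_chooseSum (p := p) hc
    have h2 := Nat.choose_le_choose p (show a ≤ c by omega)
    omega
  refine ⟨_, (TailPattern.add_range a M hle).add_zeros (q + g - (M.card + a)), ?_, ?_⟩
  · simp; omega
  · rw [chooseSum_add, chooseSum_add, chooseSum_replicate, chooseSum_range,
      Nat.choose_eq_zero_of_lt hp, hsum]
    omega

theorem Attains.isolated {p k F : ℕ} (hp : 0 < p) (h : Attains p k F) : Attains p (k + 1) F := by
  obtain ⟨M, hM, rfl, rfl⟩ := h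
  refine ⟨_, hM.isolated, by simp, ?_⟩
  rw [chooseSum_cons, Nat.choose_eq_zero_of_lt hp, zero_add]

theorem Attains.dominating {p k F : ℕ} (h : Attains p k F) :
    Attains p (k + 1) (k.choose p + F) := by
  obtain ⟨M, hM, rfl, rfl⟩ := h
  exact ⟨_, hM.dominating, by simp, chooseSum_cons _ _ _⟩

theorem choose_pred_le_choose {k p : ℕ} (h : 2 * p ≤ k + 1) : k.choose (p - 1) ≤ k.choose p := by
  rcases p with _ | p
  · simp
  · have := Nat.choose_succ_right_eq k p
    refine Nat.le_of_mul_le_mul_right (c := p + 1) ?_ (by omega)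
    rw [this, Nat.add_sub_cancel]
    exact Nat.mul_le_mul_left _ (by omega)

theorem attains_of_add_lt {p k₀ X : ℕ} (hp : 0 < p) (hk₀ : 2 * p ≤ k₀ + 1)
    (hX : k₀.choose p ≤ X) (h : ∀ F < X, Attains p k₀ F) :
    ∀ k, k₀ ≤ k → k.choose p + k₀.choose (p + 1) ≤ k.choose (p + 1) + X ∧
      ∀ F, F + k₀.choose (p + 1) < k.choose (p + 1) + X → Attains p k F := by
  intro k hk
  induction k, hk using Nat.le_induction with
  | base => exact ⟨by omega, fun F hF => h F (by omega)⟩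
  | succ k hk ih =>
    obtain ⟨ih1, ih2⟩ := ih
    have h1 := Nat.choose_succ_succ k p
    have h2 : (k + 1).choose p = k.choose (p - 1) + k.choose p := by
      obtain ⟨p, rfl⟩ := Nat.exists_eq_succ_of_ne_zero hp.ne'
      exact Nat.choose_succ_succ k p
    have h3 := choose_pred_le_choose (k := k) (p := p) (by omega)
    simp only [Nat.succ_eq_add_one] at h1
    refine ⟨by omega, fun F hF => ?_⟩
    rcases lt_or_ge F (k.choose p) with hlt | hge
    · exact (ih2 F (by omega)).isolated hp
    · have := (ih2 (F - k.choose p) (by omega)).dominating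
      rwa [Nat.add_sub_cancel' hge] at this

theorem Represents.double {p s Y : ℕ} (hp : 0 < p) (hY : (2 * p).choose p ≤ Y)
    (h : Represents p s Y) : Represents p (s + 1) (2 * Y) := by
  intro F hF
  rcases lt_or_ge F Y with hlt | hge
  · obtain ⟨M, hM, hs⟩ := h F hlt
    exact ⟨M, by omega, hs⟩
  · obtain ⟨a, hba, ha, ha'⟩ := exists_choose_le_lt hp (hY.trans hge)
    have h2 : (a + 1).choose p = a.choose (p - 1) + a.choose p := by
      obtain ⟨p, rfl⟩ := Nat.exists_eq_succ_of_ne_zero hp.ne'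
      exact Nat.choose_succ_succ a p
    have h3 := choose_pred_le_choose (k := a) (p := p) (by omega)
    obtain ⟨M, hM, hs⟩ := h (F - a.choose p) (by omega)
    refine ⟨a ::ₘ M, by simpa using hM, ?_⟩
    rw [chooseSum_cons, hs]
    omega

theorem Represents.two_pow {p s Y : ℕ} (hp : 0 < p) (hY : (2 * p).choose p ≤ Y)
    (h : Represents p s Y) (t : ℕ) : Represents p (s + t) (2 ^ t * Y) := by
  induction t with
  | zero => simpa using h
  | succ t ih =>
    have := ih.double hp (hY.trans (Nat.le_mul_of_pos_left _ (by positivity)))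
    rwa [← mul_assoc, ← pow_succ', add_assoc] at this

theorem Represents.mono {p s X Y : ℕ} (h : Represents p s Y) (hXY : X ≤ Y) : Represents p s X :=
  fun F hF => h F (hF.trans_le hXY)

theorem Represents.succ_choose {p s i n : ℕ} (hn : p ≤ n * (i + 1))
    (h : Represents p s ((p + i).choose p)) : Represents p (s + n) ((p + i + 1).choose p) := by
  intro F hF
  have hpos : 0 < (p + i).choose p := Nat.choose_pos (by omega)
  have hmul : (p + i + 1).choose p * (i + 1) = (p + i + 1) * (p + i).choose p := by
    have := Nat.choose_mul_succ_eq (p + i) p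
    rw [show p + i + 1 - p = i + 1 by omega] at this
    rw [← this, mul_comm]
  have hquot : F / (p + i).choose p ≤ n := by
    rw [← Nat.lt_succ_iff, Nat.div_lt_iff_lt_mul hpos]
    refine hF.trans_le (Nat.le_of_mul_le_mul_right (c := i + 1) ?_ (by omega))
    rw [hmul]
    nlinarith
  obtain ⟨M, hM, hs⟩ := h _ (Nat.mod_lt F hpos)
  refine ⟨M + Multiset.replicate (F / (p + i).choose p) (p + i), by simp; omega, ?_⟩
  rw [chooseSum_add, hs, chooseSum_replicate]
  exact Nat.mod_add_div' F _

theorem represents_sum (p j : ℕ) :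
    Represents p (∑ i ∈ Finset.range j, ((p + i) / (i + 1))) ((p + j).choose p) := by
  induction j with
  | zero =>
    intro F hF
    have : F = 0 := by simpa using hF
    exact ⟨0, by simp, by simp [chooseSum, this]⟩
  | succ j ih =>
    rw [Finset.sum_range_succ]
    refine ih.succ_choose ?_
    have := Nat.div_add_mod (p + j) (j + 1)
    have := Nat.mod_lt (p + j) (Nat.succ_pos j)
    nlinarith

theorem represents_two_pow_mul {p : ℕ} (hp : 0 < p) (t : ℕ) :
    Represents p (∑ i ∈ Finset.range p, ((p + i) / (i + 1)) + t) (2 ^ t * (2 * p).choose p) := by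
  have := represents_sum p p
  rw [← two_mul] at this
  exact this.two_pow hp le_rfl t

theorem choose_add_mul_pow_le {p a : ℕ} (N g : ℕ) (h : N + p ≤ a + 1) :
    (a + g).choose p * N ^ p ≤ a.choose p * (N + g) ^ p := by
  have key : ∀ k, N + k ≤ a + 1 →
      (a + g).descFactorial k * N ^ k ≤ a.descFactorial k * (N + g) ^ k := by
    intro k
    induction k with
    | zero => simp
    | succ k ih =>
      intro hk
      obtain ⟨b, rfl⟩ := Nat.exists_eq_add_of_le (show N + k ≤ a by omega)
      have h1 : N + k + b + g - k = N + b + g := by omega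
      have h2 : N + k + b - k = N + b := by omega
      rw [Nat.descFactorial_succ, Nat.descFactorial_succ, h1, h2, pow_succ, pow_succ]
      calc _ = ((N + b + g) * N) * ((N + k + b + g).descFactorial k * N ^ k) := by ring
        _ ≤ ((N + b) * (N + g)) * ((N + k + b).descFactorial k * (N + g) ^ k) :=
            Nat.mul_le_mul (by nlinarith) (ih (by omega))
        _ = _ := by ring
  have := key p h
  rw [Nat.descFactorial_eq_factorial_mul_choose, Nat.descFactorial_eq_factorial_mul_choose,
    mul_assoc, mul_assoc] at this
  exact Nat.le_of_mul_le_mul_left this p.factorial_pos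

theorem choose_mul_pow_le {p a : ℕ} (d : ℕ) :
    a.choose p * (a + d) ^ p ≤ (a + d).choose p * a ^ p := by
  have key : ∀ k, a.descFactorial k * (a + d) ^ k ≤ (a + d).descFactorial k * a ^ k := by
    intro k
    induction k with
    | zero => simp
    | succ k ih =>
      rw [Nat.descFactorial_succ, Nat.descFactorial_succ, pow_succ, pow_succ]
      calc _ = ((a - k) * (a + d)) * (a.descFactorial k * (a + d) ^ k) := by ring
        _ ≤ ((a + d - k) * a) * ((a + d).descFactorial k * a ^ k) := by
            refine Nat.mul_le_mul ?_ ih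
            rcases le_total a k with h | h
            · simp [Nat.sub_eq_zero_of_le h]
            · obtain ⟨b, rfl⟩ := Nat.exists_eq_add_of_le h
              have h1 : k + b - k = b := by omega
              have h2 : k + b + d - k = b + d := by omega
              rw [h1, h2]
              nlinarith [Nat.zero_le (k * d)]
        _ = _ := by ring
  have := key p
  rw [Nat.descFactorial_eq_factorial_mul_choose, Nat.descFactorial_eq_factorial_mul_choose,
    mul_assoc, mul_assoc] at this
  exact Nat.le_of_mul_le_mul_left this p.factorial_pos

theorem two_mul_choose_le {r k K : ℕ} (hr : 0 < r) (hk : 0 < k) (h : (r + 1) * k ≤ r * K) :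
    2 * k.choose r ≤ K.choose r := by
  have hkK : k ≤ K := by nlinarith
  obtain ⟨d, rfl⟩ := Nat.exists_eq_add_of_le hkK
  have h1 : 2 * k ^ r ≤ (k + d) ^ r := by
    have h2 : (2 : ℝ) ≤ (1 + 1 / (r : ℝ)) ^ r := by
      have := one_add_mul_le_pow (a := 1 / (r : ℝ)) (by
        have : (0 : ℝ) ≤ 1 / (r : ℝ) := by positivity
        linarith) r
      have h3 : (r : ℝ) * (1 / r) = 1 := by field_simp
      linarith
    have h4 : (k : ℝ) * (1 + 1 / r) ≤ k + d := by
      have : ((r : ℝ) + 1) * k ≤ r * (k + d) := by exact_mod_cast h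
      have hr' : (0 : ℝ) < r := by exact_mod_cast hr
      rw [← mul_le_mul_iff_right₀ hr']
      calc _ = ((r : ℝ) + 1) * k := by field_simp
        _ ≤ _ := this
    have h5 : (2 : ℝ) * (k : ℝ) ^ r ≤ ((k : ℝ) + d) ^ r := by
      calc (2 : ℝ) * (k : ℝ) ^ r ≤ (1 + 1 / (r : ℝ)) ^ r * (k : ℝ) ^ r := by gcongr
        _ = ((k : ℝ) * (1 + 1 / r)) ^ r := by rw [mul_pow, mul_comm]
        _ ≤ _ := by gcongr
    exact_mod_cast h5
  have h6 := choose_mul_pow_le (p := r) (a := k) d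
  refine Nat.le_of_mul_le_mul_right (c := k ^ r) ?_ (by positivity)
  calc 2 * k.choose r * k ^ r = k.choose r * (2 * k ^ r) := by ring
    _ ≤ k.choose r * (k + d) ^ r := by gcongr
    _ ≤ _ := h6

theorem sum_ceil_div_le {p : ℕ} (hp : 0 < p) :
    ((∑ i ∈ Finset.range p, (p + i) / (i + 1) : ℕ) : ℝ) ≤ p * (2 + Real.log p) := by
  have h1 : ((harmonic p : ℚ) : ℝ) ≤ 1 + Real.log p := harmonic_le_one_add_log p
  have h2 : ((∑ i ∈ Finset.range p, (p + i) / (i + 1) : ℕ) : ℝ) ≤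
      ∑ i ∈ Finset.range p, (1 + (p : ℝ) * ((i : ℝ) + 1)⁻¹) := by
    push_cast
    refine Finset.sum_le_sum fun i _ => ?_
    refine (Nat.cast_div_le (α := ℝ)).trans ?_
    push_cast
    rw [div_le_iff₀ (by positivity)]
    have : (1 + (p : ℝ) * ((i : ℝ) + 1)⁻¹) * ((i : ℝ) + 1) = i + 1 + p := by field_simp
    linarith
  have h3 : ∑ i ∈ Finset.range p, (1 + (p : ℝ) * ((i : ℝ) + 1)⁻¹) =
      p + p * ((harmonic p : ℚ) : ℝ) := by
    rw [Finset.sum_add_distrib, ← Finset.mul_sum, harmonic]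
    push_cast
    simp
  have hp' : (0 : ℝ) < p := by exact_mod_cast hp
  rw [h3] at h2
  nlinarith

theorem choose_le_two_pow_mul {p t : ℕ} (hp : 0 < p)
    (ht : p * Real.log (3 * (p + 1)) ≤ t * Real.log 2) :
    (3 * (p + 1) ^ 2).choose p ≤ 2 ^ t * (2 * p).choose p := by
  have h0 : 2 * p ≤ 3 * (p + 1) ^ 2 := by nlinarith
  obtain ⟨g, hg⟩ := Nat.exists_eq_add_of_le h0
  have h1 := choose_add_mul_pow_le (p := p) (a := 2 * p) (p + 1) g (by omega)
  rw [← hg] at h1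
  have h2 : p + 1 + g ≤ 3 * (p + 1) * (p + 1) := by nlinarith
  have h3 : (3 * (p + 1)) ^ p ≤ 2 ^ t := by
    have : ((3 * ((p : ℝ) + 1))) ^ p ≤ 2 ^ t := by
      rw [← Real.log_le_log_iff (by positivity) (by positivity), Real.log_pow, Real.log_pow]
      exact ht
    exact_mod_cast this
  refine Nat.le_of_mul_le_mul_right (c := (p + 1) ^ p) ?_ (by positivity)
  calc _ ≤ (2 * p).choose p * (p + 1 + g) ^ p := h1
    _ ≤ (2 * p).choose p * (3 * (p + 1) * (p + 1)) ^ p := by gcongr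
    _ = (3 * (p + 1)) ^ p * (2 * p).choose p * (p + 1) ^ p := by rw [mul_pow]; ring
    _ ≤ _ := by gcongr

theorem choose_add_le_choose_succ {p g : ℕ}
    (hg : (g : ℝ) ≤ 3 * (p + 1) * Real.log (3 * (p + 1))) :
    (3 * (p + 1) ^ 2 + g).choose p ≤ (3 * (p + 1) ^ 2 + 1).choose (p + 1) := by
  obtain ⟨N, hN⟩ := Nat.exists_eq_add_of_le (show p ≤ 3 * (p + 1) ^ 2 + 1 by nlinarith)
  have hNpos : 3 * (p + 1) * p ≤ N := by nlinarith
  have hN0 : 0 < N := by nlinarith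
  have h1 := choose_add_mul_pow_le (p := p) (a := 3 * (p + 1) ^ 2) N g (by omega)
  have h2 : (N + g) ^ p ≤ 3 * (p + 1) * N ^ p := by
    have hN' : (0 : ℝ) < N := by exact_mod_cast hN0
    have h3 : (1 + (g : ℝ) / N) ^ p ≤ 3 * ((p : ℝ) + 1) := by
      calc (1 + (g : ℝ) / N) ^ p ≤ Real.exp ((g : ℝ) / N) ^ p := by
            gcongr
            rw [add_comm]
            exact Real.add_one_le_exp _
        _ = Real.exp (p * ((g : ℝ) / N)) := (Real.exp_nat_mul _ _).symm
        _ ≤ Real.exp (Real.log (3 * (p + 1))) := by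
            gcongr
            have hlog : 0 ≤ Real.log (3 * ((p : ℝ) + 1)) :=
              Real.log_nonneg (by nlinarith [(Nat.cast_nonneg p : (0 : ℝ) ≤ p)])
            rw [← mul_div_assoc, div_le_iff₀ hN']
            have : 3 * ((p : ℝ) + 1) * p ≤ N := by exact_mod_cast hNpos
            calc (p : ℝ) * g ≤ p * (3 * (p + 1) * Real.log (3 * (p + 1))) := by gcongr
              _ = Real.log (3 * (p + 1)) * (3 * (p + 1) * p) := by ring
              _ ≤ _ := by gcongr
        _ = _ := Real.exp_log (by positivity)
    have h4 : ((N : ℝ) + g) ^ p ≤ 3 * (p + 1) * (N : ℝ) ^ p := by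
      calc ((N : ℝ) + g) ^ p = (1 + (g : ℝ) / N) ^ p * (N : ℝ) ^ p := by
            rw [← mul_pow]
            congr 1
            field_simp
        _ ≤ _ := by gcongr
    exact_mod_cast h4
  have h5 : (3 * (p + 1) ^ 2 + g).choose p ≤ (3 * (p + 1) ^ 2).choose p * (3 * (p + 1)) := by
    refine Nat.le_of_mul_le_mul_right (c := N ^ p) ?_ (by positivity)
    calc _ ≤ _ := h1
      _ ≤ (3 * (p + 1) ^ 2).choose p * (3 * (p + 1) * N ^ p) := by gcongr
      _ = _ := by ring
  have h6 := Nat.add_one_mul_choose_eq (3 * (p + 1) ^ 2) p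
  refine Nat.le_of_mul_le_mul_right (c := p + 1) ?_ (by omega)
  rw [← h6]
  nlinarith

theorem exists_represents_of_five_le {p : ℕ} (hp : 5 ≤ p) :
    ∃ g, Represents p g ((3 * (p + 1) ^ 2).choose p) ∧
      (3 * (p + 1) ^ 2 + g).choose p ≤ (3 * (p + 1) ^ 2 + 1).choose (p + 1) ∧
      3 * (p + 1) ^ 2 + g ≤ 5 * (p + 1) ^ 2 ∧
      2 * (3 * (p + 1) ^ 2 + g).choose (p + 1) <
        (5 * (p + 1) ^ 2).choose (p + 1) + 2 * (3 * (p + 1) ^ 2 + 1).choose (p + 1) := by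
  set y := Real.log (3 * (p + 1)) with hy
  have hp' : (5 : ℝ) ≤ p := by exact_mod_cast hp
  have hlog2 : 0.6931471803 < Real.log 2 := Real.log_two_gt_d9
  have hlog2' : Real.log 2 < 0.6931471808 := Real.log_two_lt_d9
  have hlogp : Real.log p ≤ y - 1 := by
    have h3 : Real.exp 1 ≤ 3 := by linarith [Real.exp_one_lt_d9]
    have : Real.log (p * Real.exp 1) ≤ y :=
      Real.log_le_log (by positivity) (by nlinarith [Real.exp_pos 1])
    rw [Real.log_mul (by positivity) (by positivity), Real.log_exp] at this
    linarith
  have hy2 : 2 ≤ y := by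
    have : Real.log (2 ^ 4) ≤ y := Real.log_le_log (by positivity) (by linarith)
    rw [Real.log_pow] at this
    push_cast at this
    linarith
  have hyle : y ≤ 1.7726 + 0.1875 * (p + 1) := by
    have h1 : y = Real.log (2 ^ 4) + Real.log (3 * (p + 1) / 2 ^ 4) := by
      rw [← Real.log_mul (by positivity) (by positivity), hy]
      congr 1
      ring
    have h2 := Real.log_le_sub_one_of_pos (show 0 < 3 * ((p : ℝ) + 1) / 2 ^ 4 by positivity)
    rw [h1, Real.log_pow]
    push_cast
    linarith
  set t := ⌈p * y / Real.log 2⌉₊ with ht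
  have ht1 : p * y ≤ t * Real.log 2 := by
    rw [← div_le_iff₀ (by linarith)]
    exact Nat.le_ceil _
  have ht2 : (t : ℝ) ≤ 1.45 * (p * y) + 1 := by
    have h1 : (t : ℝ) < p * y / Real.log 2 + 1 := Nat.ceil_lt_add_one (by positivity)
    have h2 : p * y / Real.log 2 ≤ 1.45 * (p * y) := by
      rw [div_le_iff₀ (by linarith)]
      have : 0 ≤ p * y := by positivity
      nlinarith
    linarith
  set g := ∑ i ∈ Finset.range p, ((p + i) / (i + 1)) + t with hg
  have hgle : (g : ℝ) ≤ p * (1 + 2.45 * y) + 1 := by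
    have h1 := sum_ceil_div_le (show 0 < p by omega)
    rw [hg, Nat.cast_add]
    nlinarith
  have hfinal : (p + 1 + 1) * (3 * (p + 1) ^ 2 + g) ≤ (p + 1) * (5 * (p + 1) ^ 2) := by
    have h1 : (g : ℝ) ≤ p * (1 + 2.45 * (1.7726 + 0.1875 * (p + 1))) + 1 := by
      refine hgle.trans ?_
      gcongr
    have h2 : ((p : ℝ) + 1 + 1) * (3 * (p + 1) ^ 2 + g) ≤ (p + 1) * (5 * (p + 1) ^ 2) := by
      have h3 : ((p : ℝ) + 2) * g ≤
          (p + 2) * (p * (1 + 2.45 * (1.7726 + 0.1875 * (p + 1))) + 1) := by gcongr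
      obtain ⟨z, hz⟩ : ∃ z : ℝ, (p : ℝ) = 5 + z := ⟨p - 5, by ring⟩
      have hz0 : 0 ≤ z := by linarith
      rw [hz] at h3 ⊢
      nlinarith [pow_nonneg hz0 2, pow_nonneg hz0 3]
    exact_mod_cast h2
  refine ⟨g, (represents_two_pow_mul (by omega) t).mono (choose_le_two_pow_mul (by omega) ht1),
    choose_add_le_choose_succ ?_, ?_, ?_⟩
  · refine hgle.trans ?_
    nlinarith
  · nlinarith
  · have := two_mul_choose_le (by omega) (by positivity) hfinal
    have : 0 < (3 * (p + 1) ^ 2 + 1).choose (p + 1) := Nat.choose_pos (by nlinarith)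
    omega

theorem exists_represents {p : ℕ} (hp : 2 ≤ p) :
    ∃ g, Represents p g ((3 * (p + 1) ^ 2).choose p) ∧
      (3 * (p + 1) ^ 2 + g).choose p ≤ (3 * (p + 1) ^ 2 + 1).choose (p + 1) ∧
      3 * (p + 1) ^ 2 + g ≤ 5 * (p + 1) ^ 2 ∧
      2 * (3 * (p + 1) ^ 2 + g).choose (p + 1) <
        (5 * (p + 1) ^ 2).choose (p + 1) + 2 * (3 * (p + 1) ^ 2 + 1).choose (p + 1) := by
  rcases le_or_gt 5 p with h | h
  · exact exists_represents_of_five_le h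
  · have hsum : (∑ i ∈ Finset.range 2, (2 + i) / (i + 1) = 3) ∧
        (∑ i ∈ Finset.range 3, (3 + i) / (i + 1) = 6) ∧
        (∑ i ∈ Finset.range 4, (4 + i) / (i + 1) = 9) := by decide
    interval_cases p
    · refine ⟨9, ?_, by simp [Nat.choose], by norm_num, by norm_num [Nat.choose]⟩
      have := represents_two_pow_mul (p := 2) (by norm_num) 6
      rw [hsum.1] at this
      exact this.mono (by norm_num [Nat.choose])
    · refine ⟨16, ?_, by norm_num [Nat.choose], by norm_num, by norm_num [Nat.choose]⟩
      have := represents_two_pow_mul (p := 3) (by norm_num) 10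
      rw [hsum.2.1] at this
      exact this.mono (by norm_num [Nat.choose])
    · refine ⟨24, ?_, by norm_num [Nat.choose], by norm_num, by norm_num [Nat.choose]⟩
      have := represents_two_pow_mul (p := 4) (by norm_num) 15
      rw [hsum.2.2] at this
      exact this.mono (by norm_num [Nat.choose])

/-- Every `F` at most half of `m.choose (p + 1)` is the value of a tail pattern on `m` vertices. -/
theorem attains_of_two_mul_le {p m F : ℕ} (hp : 2 ≤ p) (hm : 5 * (p + 1) ^ 2 ≤ m)
    (hF : 2 * F ≤ m.choose (p + 1)) : Attains p m F := by
  obtain ⟨g, hrep, hX, hle, hlt⟩ := exists_represents hp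
  refine (attains_of_add_lt (by omega) (by nlinarith) hX (hrep.attains (by omega)) m
    (hle.trans hm)).2 F ?_
  have := Nat.choose_le_choose (p + 1) hm
  omega

theorem exists_forward_or_homogeneous {α : Type*} [LinearOrder α] (Q : α → α → Prop) {K : ℕ}
    (hK : 0 < K) (h : ℕ) :
    ∀ A : Finset α, K * h ≤ A.card →
      (∃ v ∈ A, ∃ B ⊆ A, K ≤ B.card ∧ ∀ y ∈ B, v < y ∧ Q v y) ∨
        ∃ S ⊆ A, S.card = h ∧ ∀ x ∈ S, ∀ y ∈ S, x < y → ¬ Q x y := by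
  classical
  induction h with
  | zero => exact fun A _ => Or.inr ⟨∅, by simp, rfl, by simp⟩
  | succ h ih =>
    intro A hA
    have hne : A.Nonempty := Finset.card_pos.1 (by nlinarith)
    set v := A.min' hne with hv
    have hvA : v ∈ A := A.min'_mem hne
    by_cases hB : K ≤ (A.filter fun y => v < y ∧ Q v y).card
    · exact Or.inl ⟨v, hvA, _, A.filter_subset _, hB, fun y hy => (Finset.mem_filter.1 hy).2⟩
    · have hcover : A ⊆ insert v ((A.filter fun y => v < y ∧ Q v y) ∪
          (A.filter fun y => v < y ∧ ¬ Q v y)) := by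
        intro y hy
        rcases (A.min'_le y hy).eq_or_lt with heq | hlt
        · exact Finset.mem_insert.2 (Or.inl heq.symm)
        · change v < y at hlt
          by_cases hQ : Q v y <;> simp [hy, hQ, hlt]
      have hcard := (Finset.card_le_card hcover).trans
        ((Finset.card_insert_le _ _).trans (Nat.succ_le_succ (Finset.card_union_le _ _)))
      rcases ih (A.filter fun y => v < y ∧ ¬ Q v y) (by rw [mul_add] at hA; omega) with
        ⟨w, hw, B, hBA, hBK, hBQ⟩ | ⟨S, hSA, hSh, hS⟩
      · exact Or.inl ⟨w, Finset.filter_subset _ _ hw, B, hBA.trans (Finset.filter_subset _ _),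
          hBK, hBQ⟩
      · have hvS : ∀ y ∈ S, v < y ∧ ¬ Q v y := fun y hy => (Finset.mem_filter.1 (hSA hy)).2
        refine Or.inr ⟨insert v S, Finset.insert_subset hvA (hSA.trans (Finset.filter_subset _ _)),
          ?_, ?_⟩
        · rw [Finset.card_insert_of_notMem fun hmem => (hvS v hmem).1.false, hSh]
        · intro x hx y hy hxy
          rcases Finset.mem_insert.1 hx with rfl | hx
          · rcases Finset.mem_insert.1 hy with rfl | hy
            · exact absurd hxy (lt_irrefl _)
            · exact (hvS y hy).2
          · rcases Finset.mem_insert.1 hy with rfl | hy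
            · exact absurd ((hvS x hx).1.trans hxy) (lt_irrefl _)
            · exact hS x hx y hy hxy

open Classical in
/-- The neighbours of `v` in `T` that come after `v`. -/
noncomputable def forwardNbrs {α : Type*} [LinearOrder α] (R : α → α → Prop) (T : Finset α)
    (v : α) : Finset α :=
  T.filter fun y => v < y ∧ R v y

theorem mem_forwardNbrs {α : Type*} [LinearOrder α] {R : α → α → Prop} {T : Finset α} {v y : α} :
    y ∈ forwardNbrs R T v ↔ y ∈ T ∧ v < y ∧ R v y := by
  simp [forwardNbrs]

/-- Forward neighbourhoods in `T` are final segments of `T`, with sizes listed by `M`. -/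
def IsTailCopy {α : Type*} [LinearOrder α] (R : α → α → Prop) (T : Finset α)
    (M : Multiset ℕ) : Prop :=
  (∀ x ∈ T, ∀ y ∈ T, ∀ z ∈ T, x < y → y < z → R x y → R x z) ∧
    T.val.map (fun v => (forwardNbrs R T v).card) = M

theorem IsTailCopy.insert_first {α : Type*} [LinearOrder α] {R : α → α → Prop} {T : Finset α}
    {M : Multiset ℕ} (h : IsTailCopy R T M) {v : α} (hv : ∀ y ∈ T, v < y)
    (hR : ∀ y ∈ T, ∀ z ∈ T, R v y → R v z) :
    IsTailCopy R (insert v T) ((forwardNbrs R T v).card ::ₘ M) := by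
  have hvT : v ∉ T := fun hmem => (hv v hmem).false
  refine ⟨?_, ?_⟩
  · intro x hx y hy z hz hxy hyz hR'
    rcases Finset.mem_insert.1 hx with rfl | hx
    · exact hR y (Finset.mem_of_mem_insert_of_ne hy hxy.ne') z
        (Finset.mem_of_mem_insert_of_ne hz (hxy.trans hyz).ne') hR'
    · exact h.1 x hx y (Finset.mem_of_mem_insert_of_ne hy ((hv x hx).trans hxy).ne') z
        (Finset.mem_of_mem_insert_of_ne hz ((hv x hx).trans (hxy.trans hyz)).ne') hxy hyz hR'
  · rw [Finset.insert_val_of_notMem hvT, Multiset.map_cons]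
    have hins : ∀ w ∈ insert v T, forwardNbrs R (insert v T) w = forwardNbrs R T w := by
      intro w hw
      have hvw : v ≤ w := by
        rcases Finset.mem_insert.1 hw with rfl | hw
        exacts [le_rfl, (hv w hw).le]
      ext y
      simp only [mem_forwardNbrs, Finset.mem_insert]
      refine ⟨fun hy => ⟨hy.1.resolve_left ?_, hy.2⟩, fun hy => ⟨Or.inr hy.1, hy.2⟩⟩
      exact (hvw.trans_lt hy.2.1).ne'
    rw [hins v (Finset.mem_insert_self _ _), ← h.2]
    congr 1
    exact Multiset.map_congr rfl fun w hw => by rw [hins w (Finset.mem_insert_of_mem hw)]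

theorem IsTailCopy.insert_last {α : Type*} [LinearOrder α] {R : α → α → Prop} {T : Finset α}
    {M : Multiset ℕ} (h : IsTailCopy R T M) {b : α} (hb : ∀ y ∈ T, y < b ∧ R y b) :
    IsTailCopy R (insert b T) (0 ::ₘ M.map Nat.succ) := by
  have hbT : b ∉ T := fun hmem => (hb b hmem).1.false
  refine ⟨?_, ?_⟩
  · intro x hx y hy z hz hxy hyz hR'
    have hlast : ∀ w ∈ insert b T, w ≤ b := by
      intro w hw
      rcases Finset.mem_insert.1 hw with rfl | hw
      exacts [le_rfl, (hb w hw).1.le]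
    have hzb := hlast z hz
    have hyT := Finset.mem_of_mem_insert_of_ne hy (hyz.trans_le hzb).ne
    have hxT := Finset.mem_of_mem_insert_of_ne hx (hxy.trans (hyz.trans_le hzb)).ne
    rcases Finset.mem_insert.1 hz with rfl | hz
    · exact (hb x hxT).2
    · exact h.1 x hxT y hyT z hz hxy hyz hR'
  · rw [Finset.insert_val_of_notMem hbT, Multiset.map_cons, ← h.2, Multiset.map_map]
    congr 1
    · rw [Finset.card_eq_zero, Finset.eq_empty_iff_forall_notMem]
      intro y hy
      obtain ⟨hy, hby, -⟩ := mem_forwardNbrs.1 hy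
      rcases Finset.mem_insert.1 hy with rfl | hy
      · exact hby.false
      · exact (hby.trans (hb y hy).1).false
    · refine Multiset.map_congr rfl fun w hw => ?_
      have : forwardNbrs R (insert b T) w = insert b (forwardNbrs R T w) := by
        ext y
        simp only [mem_forwardNbrs, Finset.mem_insert]
        constructor
        · rintro ⟨rfl | hy, hy'⟩
          exacts [Or.inl rfl, Or.inr ⟨hy, hy'⟩]
        · rintro (rfl | ⟨hy, hy'⟩)
          exacts [⟨Or.inl rfl, hb w hw⟩, ⟨Or.inr hy, hy'⟩]
      rw [this, Finset.card_insert_of_notMem fun hmem => hbT (mem_forwardNbrs.1 hmem).1]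
      rfl

/-- A set of size `h ^ k` either contains a homogeneous set of size `h` or a copy of any given tail
pattern on `k` vertices. -/
theorem TailPattern.exists_copy {α : Type*} [LinearOrder α] (R : α → α → Prop) {h : ℕ}
    (hh : 0 < h) {M : Multiset ℕ} (hM : TailPattern M) :
    ∀ A : Finset α, h ^ M.card ≤ A.card →
      (∃ T ⊆ A, IsTailCopy R T M) ∨
      ∃ S ⊆ A, S.card = h ∧ ((∀ x ∈ S, ∀ y ∈ S, x < y → R x y) ∨
        ∀ x ∈ S, ∀ y ∈ S, x < y → ¬ R x y) := by
  induction hM with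
  | nil => exact fun A _ => Or.inl ⟨∅, by simp, by simp [IsTailCopy]⟩
  | @isolated M _ ih =>
    intro A hA
    rw [Multiset.card_cons, pow_succ] at hA
    rcases exists_forward_or_homogeneous (fun x y => ¬ R x y) (pow_pos hh _) h A hA with
      ⟨v, hv, B, hBA, hB, hvB⟩ | ⟨S, hSA, hS, hSR⟩
    · rcases ih B hB with ⟨T, hTB, hT⟩ | ⟨S, hSB, hS⟩
      · refine Or.inl ⟨insert v T, Finset.insert_subset hv (hTB.trans hBA), ?_⟩
        have h1 := hT.insert_first (v := v) (fun y hy => (hvB y (hTB hy)).1)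
          (fun y hy z _ hR => absurd hR (hvB y (hTB hy)).2)
        have h2 : forwardNbrs R T v = ∅ := by
          rw [Finset.eq_empty_iff_forall_notMem]
          intro y hy
          obtain ⟨hy, -, hR⟩ := mem_forwardNbrs.1 hy
          exact (hvB y (hTB hy)).2 hR
        rwa [h2, Finset.card_empty] at h1
      · exact Or.inr ⟨S, hSB.trans hBA, hS⟩
    · exact Or.inr ⟨S, hSA, hS, Or.inl fun x hx y hy hxy => not_not.1 (hSR x hx y hy hxy)⟩
  | @dominating M _ ih =>
    intro A hA
    rw [Multiset.card_cons, pow_succ] at hA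
    rcases exists_forward_or_homogeneous R (pow_pos hh _) h A hA with
      ⟨v, hv, B, hBA, hB, hvB⟩ | ⟨S, hSA, hS, hSR⟩
    · rcases ih B hB with ⟨T, hTB, hT⟩ | ⟨S, hSB, hS⟩
      · refine Or.inl ⟨insert v T, Finset.insert_subset hv (hTB.trans hBA), ?_⟩
        have h1 := hT.insert_first (v := v) (fun y hy => (hvB y (hTB hy)).1)
          (fun y hy z hz hR => (hvB z (hTB hz)).2)
        have h2 : forwardNbrs R T v = T := by
          ext y
          rw [mem_forwardNbrs]
          exact ⟨fun hy => hy.1, fun hy => ⟨hy, hvB y (hTB hy)⟩⟩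
        have h3 : T.card = M.card := by rw [← hT.2, Multiset.card_map]; rfl
        rwa [h2, h3] at h1
      · exact Or.inr ⟨S, hSB.trans hBA, hS⟩
    · exact Or.inr ⟨S, hSA, hS, Or.inr hSR⟩
  | @append M _ ih =>
    intro A hA
    rw [Multiset.card_cons, Multiset.card_map, pow_succ] at hA
    rcases exists_forward_or_homogeneous (α := αᵒᵈ) (fun x y => R y x) (pow_pos hh _) h A hA with
      ⟨v, hv, B, hBA, hB, hvB⟩ | ⟨S, hSA, hS, hSR⟩
    · rcases ih B hB with ⟨T, hTB, hT⟩ | ⟨S, hSB, hS⟩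
      · exact Or.inl ⟨insert v T, Finset.insert_subset hv (hTB.trans hBA),
          hT.insert_last fun y hy => hvB y (hTB hy)⟩
      · exact Or.inr ⟨S, hSB.trans hBA, hS⟩
    · exact Or.inr ⟨S, hSA, hS, Or.inr fun x hx y hy hxy => hSR y hy x hx hxy⟩

/-- On `T`, membership of a `(p + 1)`-set in `E` is decided by applying `R` to its two smallest
elements. -/
def DeterminedByPair {α : Type*} [LinearOrder α] (p : ℕ) (E : Finset (Finset α))
    (R : α → α → Prop) (T : Finset α) : Prop :=
  ∀ e ⊆ T, e.card = p + 1 → ∀ x ∈ e, ∀ y ∈ e, x < y → (∀ z ∈ e, z = x ∨ y ≤ z) →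
    (e ∈ E ↔ R x y)

theorem exists_two_smallest {α : Type*} [LinearOrder α] {e : Finset α} (he : 2 ≤ e.card) :
    ∃ x ∈ e, ∃ y ∈ e, x < y ∧ ∀ z ∈ e, z = x ∨ y ≤ z := by
  have hne : e.Nonempty := Finset.card_pos.1 (by omega)
  have hne' : (e.erase (e.min' hne)).Nonempty := by
    rw [← Finset.card_pos, Finset.card_erase_of_mem (e.min'_mem hne)]
    omega
  have hy := (e.erase (e.min' hne)).min'_mem hne'
  rw [Finset.mem_erase] at hy
  refine ⟨_, e.min'_mem hne, _, hy.2, lt_of_le_of_ne (e.min'_le _ hy.2) hy.1.symm, ?_⟩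
  intro z hz
  by_cases hzx : z = e.min' hne
  · exact Or.inl hzx
  · exact Or.inr (Finset.min'_le _ _ (Finset.mem_erase.2 ⟨hzx, hz⟩))

theorem IsTailCopy.card_edges {α : Type*} [LinearOrder α] {p : ℕ} (hp : 0 < p)
    {E : Finset (Finset α)} (hE : ∀ e ∈ E, e.card = p + 1) {R : α → α → Prop} {T : Finset α}
    {M : Multiset ℕ} (hT : IsTailCopy R T M) (hdet : DeterminedByPair p E R T) :
    (E.filter (fun e => e ⊆ T)).card = chooseSum p M := by
  have hnot : ∀ v, ∀ d ⊆ forwardNbrs R T v, v ∉ d := fun v d hd hv =>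
    (mem_forwardNbrs.1 (hd hv)).2.1.false
  have hbi : E.filter (fun e => e ⊆ T) =
      T.biUnion fun v => ((forwardNbrs R T v).powersetCard p).image (insert v) := by
    ext e
    simp only [Finset.mem_filter, Finset.mem_biUnion, Finset.mem_image, Finset.mem_powersetCard]
    constructor
    · rintro ⟨heE, heT⟩
      have hcard := hE e heE
      obtain ⟨x, hx, y, hy, hxy, hmin⟩ := exists_two_smallest (e := e) (by omega)
      have hR := (hdet e heT hcard x hx y hy hxy hmin).1 heE
      refine ⟨x, heT hx, e.erase x, ⟨?_, ?_⟩, Finset.insert_erase hx⟩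
      · intro z hz
        obtain ⟨hzx, hz⟩ := Finset.mem_erase.1 hz
        have hyz := (hmin z hz).resolve_left hzx
        refine mem_forwardNbrs.2 ⟨heT hz, hxy.trans_le hyz, ?_⟩
        rcases hyz.eq_or_lt with rfl | hyz
        · exact hR
        · exact hT.1 x (heT hx) y (heT hy) z (heT hz) hxy hyz hR
      · rw [Finset.card_erase_of_mem hx, hcard, Nat.add_sub_cancel]
    · rintro ⟨v, hv, d, ⟨hd, hdp⟩, rfl⟩
      have hdT : insert v d ⊆ T :=
        Finset.insert_subset hv fun z hz => (mem_forwardNbrs.1 (hd hz)).1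
      refine ⟨?_, hdT⟩
      have hne : d.Nonempty := Finset.card_pos.1 (by omega)
      have hy := d.min'_mem hne
      have hyv := mem_forwardNbrs.1 (hd hy)
      refine (hdet _ hdT ?_ v (Finset.mem_insert_self _ _) _ (Finset.mem_insert_of_mem hy)
        hyv.2.1 ?_).2 hyv.2.2
      · rw [Finset.card_insert_of_notMem (hnot v d hd), hdp]
      · intro z hz
        rcases Finset.mem_insert.1 hz with rfl | hz
        exacts [Or.inl rfl, Or.inr (d.min'_le z hz)]
  rw [hbi, Finset.card_biUnion, ← hT.2, chooseSum, Multiset.map_map]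
  · refine Finset.sum_congr rfl fun v _ => ?_
    rw [Finset.card_image_of_injOn, Finset.card_powersetCard]
    · rfl
    · intro d hd d' hd' heq
      have h1 := hnot v d (Finset.mem_powersetCard.1 hd).1
      have h2 := hnot v d' (Finset.mem_powersetCard.1 hd').1
      rw [← Finset.erase_insert h1, ← Finset.erase_insert h2]
      exact congrArg (fun s => s.erase v) heq
  · intro v _ w _ hvw
    rw [Function.onFun, Finset.disjoint_left]
    intro e he he'
    obtain ⟨d, hd, rfl⟩ := Finset.mem_image.1 he
    obtain ⟨d', hd', heq⟩ := Finset.mem_image.1 he'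
    have hv : v ∈ insert w d' := heq ▸ Finset.mem_insert_self v d
    have hw : w ∈ insert v d := heq ▸ Finset.mem_insert_self w d'
    have h1 := (mem_forwardNbrs.1 ((Finset.mem_powersetCard.1 hd').1
      (Finset.mem_of_mem_insert_of_ne hv hvw))).2.1
    have h2 := (mem_forwardNbrs.1 ((Finset.mem_powersetCard.1 hd).1
      (Finset.mem_of_mem_insert_of_ne hw hvw.symm))).2.1
    exact (h1.trans h2).false

theorem exists_stable_subset {α : Type*} [LinearOrder α] (χ : Finset α → Prop) (j N t : ℕ) :
    ∀ V A : Finset α, V.card + t = N → (∀ x ∈ V, ∀ y ∈ A, x < y) →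
      (∀ d ⊆ V, d.card = j → ∀ y ∈ V ∪ A, ∀ y' ∈ V ∪ A, (∀ x ∈ d, x < y) → (∀ x ∈ d, x < y') →
        (χ (insert y d) ↔ χ (insert y' d))) →
      2 ^ ((N ^ j + 1) * t) ≤ A.card →
      ∃ W ⊆ V ∪ A, W.card = N ∧ ∀ d ⊆ W, d.card = j → ∀ y ∈ W, ∀ y' ∈ W, (∀ x ∈ d, x < y) →
        (∀ x ∈ d, x < y') → (χ (insert y d) ↔ χ (insert y' d)) := by
  classical
  induction t with
  | zero =>
    intro V A hV _ hinv _
    exact ⟨V, Finset.subset_union_left, hV, fun d hd hdj y hy y' hy' =>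
      hinv d hd hdj y (Finset.mem_union_left _ hy) y' (Finset.mem_union_left _ hy')⟩
  | succ t ih =>
    intro V A hV hVA hinv hA
    have hne : A.Nonempty := Finset.card_pos.1 (lt_of_lt_of_le (by positivity) hA)
    set v := A.min' hne
    have hvA : v ∈ A := A.min'_mem hne
    set f : α → Finset (Finset α) := fun y =>
      ((insert v V).powersetCard j).filter fun d => χ (insert y d)
    have hmaps : ∀ y ∈ A.erase v, f y ∈ ((insert v V).powersetCard j).powerset := fun y _ =>
      Finset.mem_powerset.2 (Finset.filter_subset _ _)
    have hclasses : ((insert v V).powersetCard j).powerset.card ≤ 2 ^ N ^ j := by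
      rw [Finset.card_powerset, Finset.card_powersetCard]
      refine Nat.pow_le_pow_right (by norm_num) ((Nat.choose_le_pow _ _).trans ?_)
      exact Nat.pow_le_pow_left ((Finset.card_insert_le _ _).trans (by omega)) j
    have herase : 2 ^ N ^ j * 2 ^ ((N ^ j + 1) * t) ≤ (A.erase v).card := by
      rw [Finset.card_erase_of_mem hvA]
      have : 2 ^ ((N ^ j + 1) * (t + 1)) = 2 * (2 ^ N ^ j * 2 ^ ((N ^ j + 1) * t)) := by ring
      have : 0 < 2 ^ N ^ j * 2 ^ ((N ^ j + 1) * t) := by positivity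
      omega
    obtain ⟨s, -, hs⟩ := Finset.exists_le_card_fiber_of_mul_le_card_of_maps_to hmaps
      ⟨∅, Finset.empty_mem_powerset _⟩ ((Nat.mul_le_mul_right _ hclasses).trans herase)
    set B := (A.erase v).filter fun y => f y = s
    have hBA : B ⊆ A := (Finset.filter_subset _ _).trans (Finset.erase_subset _ _)
    have hvB : ∀ y ∈ B, v < y := fun y hy => by
      obtain ⟨hyv, hyA⟩ := Finset.mem_erase.1 (Finset.filter_subset _ _ hy)
      exact lt_of_le_of_ne (A.min'_le y hyA) hyv.symm
    have hvV : v ∉ V := fun hv => (hVA v hv v hvA).false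
    have hsub : insert v V ∪ B ⊆ V ∪ A :=
      Finset.union_subset (Finset.insert_subset (Finset.mem_union_right _ hvA)
        Finset.subset_union_left) (hBA.trans Finset.subset_union_right)
    obtain ⟨W, hW, hWN, hWχ⟩ := ih (insert v V) B (by rw [Finset.card_insert_of_notMem hvV]; omega)
      (by
        intro x hx y hy
        rcases Finset.mem_insert.1 hx with rfl | hx
        exacts [hvB y hy, hVA x hx y (hBA hy)])
      (by
        intro d hd hdj y hy y' hy' hdy hdy'
        by_cases hvd : v ∈ d
        · have hmem : ∀ z ∈ insert v V ∪ B, v < z → z ∈ B := by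
            intro z hz hvz
            rcases Finset.mem_union.1 hz with hz | hz
            · rcases Finset.mem_insert.1 hz with rfl | hz
              exacts [absurd hvz (lt_irrefl _), absurd (hvz.trans (hVA z hz v hvA)) (lt_irrefl _)]
            · exact hz
          have h1 := (Finset.mem_filter.1 (hmem y hy (hdy v hvd))).2
          have h2 := (Finset.mem_filter.1 (hmem y' hy' (hdy' v hvd))).2
          have h3 : d ∈ f y ↔ d ∈ f y' := by rw [h1, h2]
          have h4 : d ∈ (insert v V).powersetCard j := Finset.mem_powersetCard.2 ⟨hd, hdj⟩
          simpa [f, Finset.mem_filter, h4] using h3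
        · exact hinv d ((Finset.subset_insert_iff_of_notMem hvd).1 hd) hdj y (hsub hy) y'
            (hsub hy') hdy hdy')
      hs
    exact ⟨W, hW.trans hsub, hWN, hWχ⟩

/-- For `r`-sets `e ⊆ S`, membership in `E` is decided by applying `χ` to the `j` smallest
elements of `e`. -/
def DeterminedByInitial {α : Type*} [LinearOrder α] (r j : ℕ) (E : Finset (Finset α))
    (χ : Finset α → Prop) (S : Finset α) : Prop :=
  ∀ d u : Finset α, d ∪ u ⊆ S → d.card = j → d.card + u.card = r →
    (∀ x ∈ d, ∀ y ∈ u, x < y) → (d ∪ u ∈ E ↔ χ d)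

theorem DeterminedByInitial.exists_step {α : Type*} [LinearOrder α] {r j : ℕ} (hj₀ : 0 < j) (hj : j < r)
    {E : Finset (Finset α)} {χ : Finset α → Prop} {S : Finset α}
    (h : DeterminedByInitial r (j + 1) E χ S) {N : ℕ} (hN : 2 ^ ((N ^ j + 1) * N) ≤ S.card) :
    ∃ W χ', W.card = N ∧ DeterminedByInitial r j E χ' W := by
  obtain ⟨W, hW, hWN, hWχ⟩ := exists_stable_subset χ j N N ∅ S (by simp) (by simp)
    (by
      intro d hd hdj y _ y' _ hdy hdy'
      obtain rfl := Finset.subset_empty.1 hd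
      exact absurd hdj (by simpa using hj₀.ne)) hN
  rw [Finset.empty_union] at hW
  refine ⟨W, fun d => ∃ y ∈ W, (∀ x ∈ d, x < y) ∧ χ (insert y d), hWN, ?_⟩
  intro d u hdu hdj hcard hlt
  have hne : u.Nonempty := Finset.card_pos.1 (by omega)
  have hy := u.min'_mem hne
  set y := u.min' hne
  have hyd : y ∉ d := fun hyd => (hlt y hyd y hy).false
  have hunion : d ∪ u = insert y d ∪ u.erase y := by
    rw [Finset.insert_union, ← Finset.union_insert, Finset.insert_erase hy]
  have hyW : y ∈ W := hdu (Finset.mem_union_right _ hy)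
  have hdW : d ⊆ W := Finset.subset_union_left.trans hdu
  have key := h (insert y d) (u.erase y) (hunion ▸ hdu.trans hW)
    (by rw [Finset.card_insert_of_notMem hyd, hdj])
    (by rw [Finset.card_insert_of_notMem hyd, Finset.card_erase_of_mem hy]
        have := Finset.card_pos.2 hne
        omega)
    (by
      intro x hx z hz
      obtain ⟨hzy, hz⟩ := Finset.mem_erase.1 hz
      rcases Finset.mem_insert.1 hx with rfl | hx
      exacts [lt_of_le_of_ne (u.min'_le z hz) hzy.symm, hlt x hx z hz])
  rw [hunion, key]
  constructor
  · exact fun hχ => ⟨y, hyW, fun x hx => hlt x hx y hy, hχ⟩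
  · rintro ⟨y', hy', hdy', hχ⟩
    exact (hWχ d hdW hdj y hyW y' hy' (fun x hx => hlt x hx y hy) hdy').2 hχ

theorem DeterminedByInitial.determinedByPair {α : Type*} [LinearOrder α] {p : ℕ}
    {E : Finset (Finset α)} {χ : Finset α → Prop} {S T : Finset α}
    (h : DeterminedByInitial (p + 1) 2 E χ S) (hT : T ⊆ S) :
    DeterminedByPair p E (fun x y => χ {x, y}) T := by
  intro e he hcard x hx y hy hxy hmin
  have hsub : ({x, y} : Finset α) ⊆ e := by
    intro z hz
    rcases Finset.mem_insert.1 hz with rfl | hz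
    exacts [hx, Finset.mem_singleton.1 hz ▸ hy]
  have hunion : {x, y} ∪ e \ {x, y} = e := Finset.union_sdiff_of_subset hsub
  have key := h {x, y} (e \ {x, y}) (hunion.symm ▸ he.trans hT) (Finset.card_pair hxy.ne)
    (by rw [add_comm, Finset.card_sdiff_add_card_eq_card hsub, hcard])
    (by
      intro a ha b hb
      obtain ⟨hbe, hb⟩ := Finset.mem_sdiff.1 hb
      simp only [Finset.mem_insert, Finset.mem_singleton, not_or] at ha hb
      have hyb := lt_of_le_of_ne ((hmin b hbe).resolve_left hb.1) (Ne.symm hb.2)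
      rcases ha with rfl | rfl
      exacts [hxy.trans hyb, hyb])
  rwa [hunion] at key

theorem tendsto_iterLog (k : ℕ) :
    Filter.Tendsto (fun n : ℕ => iterLog k (n : ℝ)) Filter.atTop Filter.atTop := by
  induction k with
  | zero => exact tendsto_natCast_atTop_atTop
  | succ k ih => exact (Real.tendsto_logb_atTop (by norm_num)).comp ih

theorem exists_step_size (j : ℕ) {δ : ℝ} (hδ : 0 < δ) :
    ∃ δ' : ℝ, 0 < δ' ∧ ∃ x₀ : ℝ, ∀ x ≥ x₀, ∀ s : ℕ, x ^ δ ≤ s →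
      ∃ N : ℕ, Real.logb 2 x ^ δ' ≤ N ∧ 2 ^ ((N ^ j + 1) * N) ≤ s := by
  set δ' : ℝ := 1 / (2 * (j + 2)) with hδ'
  have hδ'pos : 0 < δ' := by positivity
  refine ⟨δ', hδ'pos, max 1 ((2 : ℝ) ^ max 1 ((2 ^ (j + 2) / δ) ^ 2)), ?_⟩
  intro x hx s hs
  have hx1 : 1 ≤ x := (le_max_left _ _).trans hx
  set L := Real.logb 2 x with hL
  have hLmax : max 1 ((2 ^ (j + 2) / δ) ^ 2) ≤ L := by
    rw [hL, Real.le_logb_iff_rpow_le (by norm_num) (by linarith)]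
    exact (le_max_right _ _).trans hx
  have hL1 : 1 ≤ L := (le_max_left _ _).trans hLmax
  have hL2 : (2 ^ (j + 2) / δ) ^ 2 ≤ L := (le_max_right _ _).trans hLmax
  have hLδ : 1 ≤ L ^ δ' := Real.one_le_rpow hL1 hδ'pos.le
  have hN2 : ((⌈L ^ δ'⌉₊ : ℕ) : ℝ) ≤ 2 * L ^ δ' := by
    linarith [Nat.ceil_lt_add_one (show 0 ≤ L ^ δ' by linarith)]
  have hN1 : 1 ≤ ⌈L ^ δ'⌉₊ := Nat.one_le_ceil_iff.2 (by linarith)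
  refine ⟨⌈L ^ δ'⌉₊, Nat.le_ceil _, ?_⟩
  set N := ⌈L ^ δ'⌉₊
  have hexp : (((N ^ j + 1) * N : ℕ) : ℝ) ≤ L * δ := by
    have h1 : (((N ^ j + 1) * N : ℕ) : ℝ) ≤ 2 * (N : ℝ) ^ (j + 1) := by
      have : (N ^ j + 1) * N ≤ 2 * N ^ (j + 1) := by
        have := Nat.one_le_pow j N hN1
        calc (N ^ j + 1) * N ≤ (N ^ j + N ^ j) * N := by gcongr
          _ = _ := by ring
      exact_mod_cast this
    have hsqrt : (L ^ δ') ^ (j + 2) = √L := by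
      rw [← Real.rpow_natCast, ← Real.rpow_mul (by linarith), Real.sqrt_eq_rpow]
      congr 1
      rw [hδ']
      push_cast
      field_simp
    have h2 : 2 ^ (j + 2) / δ ≤ √L := Real.le_sqrt_of_sq_le hL2
    rw [div_le_iff₀ hδ] at h2
    calc (((N ^ j + 1) * N : ℕ) : ℝ) ≤ 2 * (N : ℝ) ^ (j + 1) := h1
      _ ≤ 2 * (2 * L ^ δ') ^ (j + 1) := by gcongr
      _ = 2 ^ (j + 2) * (L ^ δ') ^ (j + 1) := by ring
      _ ≤ 2 ^ (j + 2) * (L ^ δ') ^ (j + 2) :=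
          mul_le_mul_of_nonneg_left (pow_le_pow_right₀ hLδ (by omega)) (by positivity)
      _ ≤ (√L * δ) * √L := by rw [hsqrt]; gcongr
      _ = (√L * √L) * δ := by ring
      _ = L * δ := by rw [Real.mul_self_sqrt (by linarith)]
  have hreal : (2 : ℝ) ^ ((N ^ j + 1) * N) ≤ s := by
    calc (2 : ℝ) ^ ((N ^ j + 1) * N) = (2 : ℝ) ^ (((N ^ j + 1) * N : ℕ) : ℝ) :=
          (Real.rpow_natCast _ _).symm
      _ ≤ (2 : ℝ) ^ (L * δ) := Real.rpow_le_rpow_of_exponent_le (by norm_num) hexp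
      _ = x ^ δ := by
          rw [Real.rpow_mul (by norm_num), Real.rpow_logb (by norm_num) (by norm_num)
            (by linarith)]
      _ ≤ s := hs
  exact_mod_cast hreal

theorem exists_determinedByInitial {r : ℕ} (k : ℕ) (hk : k + 2 ≤ r) :
    ∃ δ : ℝ, 0 < δ ∧ ∃ n₀ : ℕ, ∀ n ≥ n₀, ∀ E : Finset (Finset (Fin n)),
      ∃ (S : Finset (Fin n)) (χ : Finset (Fin n) → Prop),
        iterLog k (n : ℝ) ^ δ ≤ (S.card : ℝ) ∧ DeterminedByInitial r (r - k) E χ S := by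
  induction k with
  | zero =>
    refine ⟨1, one_pos, 0, fun n _ E => ⟨Finset.univ, fun d => d ∈ E, by simp [iterLog], ?_⟩⟩
    intro d u _ hd hcard _
    obtain rfl := Finset.card_eq_zero.1 (show u.card = 0 by omega)
    rw [Finset.union_empty]
  | succ k ih =>
    obtain ⟨δ, hδ, n₀, hn₀⟩ := ih (by omega)
    obtain ⟨δ', hδ', x₀, hx₀⟩ := exists_step_size (r - (k + 1)) hδ
    obtain ⟨n₁, hn₁⟩ := Filter.eventually_atTop.1 ((tendsto_iterLog k).eventually_ge_atTop x₀)
    refine ⟨δ', hδ', max n₀ n₁, fun n hn E => ?_⟩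
    obtain ⟨S, χ, hS, hdet⟩ := hn₀ n ((le_max_left _ _).trans hn) E
    obtain ⟨N, hN, hNS⟩ := hx₀ _ (hn₁ n ((le_max_right _ _).trans hn)) _ hS
    rw [show r - k = r - (k + 1) + 1 by omega] at hdet
    obtain ⟨W, χ', hW, hdet'⟩ := hdet.exists_step (by omega) (by omega) hNS
    exact ⟨W, χ', hW.symm ▸ hN, hdet'⟩

theorem exists_homogeneous_of_two_mul_le {p m f n : ℕ} (hp : 2 ≤ p) (hm : 5 * (p + 1) ^ 2 ≤ m)
    (hf : 2 * f ≤ m.choose (p + 1)) {E : Finset (Finset (Fin n))} (hE : ∀ e ∈ E, e.card = p + 1)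
    (hmf : ¬ HasMFSubset E m f) {S : Finset (Fin n)} (hS : 0 < S.card)
    {χ : Finset (Fin n) → Prop} (hdet : DeterminedByInitial (p + 1) 2 E χ S) :
    ∃ W : Finset (Fin n), (S.card : ℝ) ^ (1 / (m : ℝ)) / 2 ≤ (W.card : ℝ) ∧
      (IsRClique (p + 1) E W ∨ IsRIndep (p + 1) E W) := by
  obtain ⟨M, hM, hMm, hMf⟩ := attains_of_two_mul_le hp hm hf
  have hm0 : 0 < m := by nlinarith
  have hS1 : (1 : ℝ) ≤ S.card := by exact_mod_cast hS
  set z := (S.card : ℝ) ^ (1 / (m : ℝ)) with hz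
  have hz1 : 1 ≤ z := Real.one_le_rpow hS1 (by positivity)
  have hh : 0 < ⌊z⌋₊ := Nat.floor_pos.2 hz1
  have hpow : ⌊z⌋₊ ^ M.card ≤ S.card := by
    have : ((⌊z⌋₊ : ℕ) : ℝ) ^ m ≤ S.card := by
      calc ((⌊z⌋₊ : ℕ) : ℝ) ^ m ≤ z ^ m := by
            gcongr
            exact Nat.floor_le (by linarith)
        _ = S.card := by
            rw [hz, one_div]
            exact Real.rpow_inv_natCast_pow (by linarith) hm0.ne'
    rw [hMm]
    exact_mod_cast this
  rcases hM.exists_copy (fun x y => χ {x, y}) hh S hpow with ⟨T, hTS, hT⟩ | ⟨W, hWS, hW, hhom⟩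
  · refine absurd ⟨T, ?_, ?_⟩ hmf
    · rw [← hMm, ← hT.2, Multiset.card_map]
      rfl
    · rw [hT.card_edges (by omega) hE (hdet.determinedByPair hTS), hMf]
  · refine ⟨W, ?_, ?_⟩
    · rw [hW]
      have h1 := Nat.lt_floor_add_one z
      have h2 : (1 : ℝ) ≤ (⌊z⌋₊ : ℕ) := by exact_mod_cast hh
      linarith
    · have hpair := hdet.determinedByPair hWS
      refine hhom.imp ?_ ?_
      · intro hR e he hcard
        obtain ⟨x, hx, y, hy, hxy, hmin⟩ := exists_two_smallest (e := e) (by omega)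
        exact (hpair e he hcard x hx y hy hxy hmin).2 (hR x (he hx) y (he hy) hxy)
      · intro hR e he hcard hmem
        obtain ⟨x, hx, y, hy, hxy, hmin⟩ := exists_two_smallest (e := e) (by omega)
        exact hR x (he hx) y (he hy) hxy ((hpair e he hcard x hx y hy hxy hmin).1 hmem)

theorem card_filter_subset_compl {n r : ℕ} {E : Finset (Finset (Fin n))}
    (hE : ∀ e ∈ E, e.card = r) (T : Finset (Fin n)) :
    ((Finset.univ.powersetCard r \ E).filter (fun e => e ⊆ T)).card +
      (E.filter (fun e => e ⊆ T)).card = T.card.choose r := by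
  rw [← Finset.card_powersetCard, ← Finset.card_union_of_disjoint]
  · congr 1
    ext e
    simp only [Finset.mem_union, Finset.mem_filter, Finset.mem_sdiff, Finset.mem_powersetCard,
      Finset.subset_univ, true_and]
    have := hE e
    tauto
  · exact Finset.disjoint_filter_filter Finset.sdiff_disjoint

theorem stmt0 (r : ℕ) (hr : 3 ≤ r) :
    ∃ c C : ℝ, 0 < c ∧ 0 < C ∧
      ∀ m : ℕ, 5 * r ^ 2 ≤ m → ∀ f : ℕ, f ≤ Nat.choose m r →
        ∃ n₀ : ℕ, ∀ n : ℕ, n₀ ≤ n →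
          ∀ E : Finset (Finset (Fin n)), (∀ e ∈ E, e.card = r) →
            ¬ HasMFSubset E m f →
            ∃ S : Finset (Fin n),
              C * iterLog (r - 2) (n : ℝ) ^ (c / (m : ℝ)) ≤ (S.card : ℝ) ∧
              (IsRClique r E S ∨ IsRIndep r E S) := by
  obtain ⟨p, rfl⟩ : ∃ p, r = p + 1 := ⟨r - 1, by omega⟩
  obtain ⟨δ, hδ, n₀, hn₀⟩ := exists_determinedByInitial (r := p + 1) (p + 1 - 2) (by omega)
  rw [show p + 1 - (p + 1 - 2) = 2 by omega] at hn₀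
  obtain ⟨n₁, hn₁⟩ :=
    Filter.eventually_atTop.1 ((tendsto_iterLog (p + 1 - 2)).eventually_ge_atTop 1)
  refine ⟨δ, 1 / 2, hδ, by norm_num, fun m hm f hf => ⟨max n₀ n₁, fun n hn E hE hmf => ?_⟩⟩
  have hL : 1 ≤ iterLog (p + 1 - 2) (n : ℝ) := hn₁ n ((le_max_right _ _).trans hn)
  have key : ∀ (E : Finset (Finset (Fin n))) (f : ℕ), (∀ e ∈ E, e.card = p + 1) →
      ¬ HasMFSubset E m f → 2 * f ≤ m.choose (p + 1) → ∃ S : Finset (Fin n),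
        1 / 2 * iterLog (p + 1 - 2) (n : ℝ) ^ (δ / (m : ℝ)) ≤ (S.card : ℝ) ∧
          (IsRClique (p + 1) E S ∨ IsRIndep (p + 1) E S) := by
    intro E f hE hmf hf
    obtain ⟨S, χ, hS, hdet⟩ := hn₀ n ((le_max_left _ _).trans hn) E
    have hS0 : 0 < S.card := by
      have := (Real.one_le_rpow hL hδ.le).trans hS
      exact_mod_cast this
    obtain ⟨W, hW, hhom⟩ := exists_homogeneous_of_two_mul_le (by omega) hm hf hE hmf hS0 hdet
    refine ⟨W, le_trans ?_ hW, hhom⟩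
    have : iterLog (p + 1 - 2) (n : ℝ) ^ (δ / (m : ℝ)) ≤ (S.card : ℝ) ^ (1 / (m : ℝ)) := by
      rw [div_eq_mul_one_div δ, Real.rpow_mul (by linarith)]
      gcongr
    linarith
  rcases le_total (2 * f) (m.choose (p + 1)) with h | h
  · exact key E f hE hmf h
  · obtain ⟨S, hS, hhom⟩ := key (Finset.univ.powersetCard (p + 1) \ E) (m.choose (p + 1) - f)
      (fun e he => (Finset.mem_powersetCard.1 (Finset.mem_sdiff.1 he).1).2)
      (by
        rintro ⟨T, hT, hTf⟩
        refine hmf ⟨T, hT, ?_⟩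
        have := card_filter_subset_compl hE T
        rw [hT, hTf] at this
        omega) (by omega)
    refine ⟨S, hS, hhom.symm.imp ?_ ?_⟩
    · intro hI e he hcard
      by_contra hmem
      exact hI e he hcard (Finset.mem_sdiff.2
        ⟨Finset.mem_powersetCard.2 ⟨Finset.subset_univ _, hcard⟩, hmem⟩)
    · intro hC e he hcard
      exact (Finset.mem_sdiff.1 (hC e he hcard)).2
end

section
/- There is a constant c > 0 such that for every r ≥ 3 there is a constant C(r) > 0 with the following property: for every integer 0 ≤ f ≤ r+1, every n-vertex r-graph (with n sufficiently large) that contains no (r+1,f)-subset contains a homogeneous set of size at least C(r) · (log_{(r-2)}(n))^c. -/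
/-- If no `x ∈ S` has at least `s` neighbours preceding it, then `S` contains an independent set
of size at least `|S| / s`. -/
lemma exists_large_backNbhd_or_indep {α β : Type*} [DecidableEq α] [LinearOrder β]
    (key : α → β) (K : Finset α → Prop) {s : ℕ} (hs : 1 ≤ s)
    (t : ℕ) (S : Finset α) (hS : s * t ≤ S.card) :
    (∃ x ∈ S, ∃ T ⊆ S, s ≤ T.card ∧ ∀ y ∈ T, key y < key x ∧ K {y, x}) ∨
      ∃ T ⊆ S, t ≤ T.card ∧ ∀ x ∈ T, ∀ y ∈ T, key y < key x → ¬ K {y, x} := by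
  classical
  induction t generalizing S with
  | zero => exact Or.inr ⟨∅, by simp, by simp, by simp⟩
  | succ t ih =>
    have hne : S.Nonempty := by
      rw [← Finset.card_pos]; nlinarith
    obtain ⟨x, hx, hmax⟩ := Finset.exists_max_image S key hne
    set D := S.filter (fun y => key y < key x ∧ K {y, x}) with hD
    by_cases hcard : s ≤ D.card
    · exact Or.inl ⟨x, hx, D, Finset.filter_subset _ _, hcard, fun y hy => by
        simpa using (Finset.mem_filter.1 hy).2⟩
    have hxD : x ∉ D := by simp [hD]
    have hsub : insert x D ⊆ S := by
      intro y hy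
      rcases Finset.mem_insert.1 hy with rfl | hy
      exacts [hx, (Finset.mem_filter.1 hy).1]
    have hc : s * t ≤ (S \ insert x D).card := by
      rw [Finset.card_sdiff_of_subset hsub, Finset.card_insert_of_notMem hxD]
      rw [mul_add] at hS
      omega
    rcases ih _ hc with ⟨z, hz, T, hT, h1, h2⟩ | ⟨T, hT, h1, h2⟩
    · exact Or.inl ⟨z, (Finset.mem_sdiff.1 hz).1, T, hT.trans Finset.sdiff_subset, h1, h2⟩
    · have hxT : x ∉ T := fun h => by simpa using hT h
      refine Or.inr ⟨insert x T, ?_, ?_, ?_⟩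
      · exact Finset.insert_subset hx (hT.trans Finset.sdiff_subset)
      · rw [Finset.card_insert_of_notMem hxT]; omega
      · intro a ha b hb hba
        rcases Finset.mem_insert.1 ha with rfl | haT
        · rcases Finset.mem_insert.1 hb with rfl | hb
          · exact absurd hba (lt_irrefl _)
          · intro hK
            have hb' := Finset.mem_sdiff.1 (hT hb)
            exact hb'.2 (Finset.mem_insert_of_mem (Finset.mem_filter.2 ⟨hb'.1, hba, hK⟩))
        · rcases Finset.mem_insert.1 hb with rfl | hb
          · exact absurd (hmax a (Finset.mem_sdiff.1 (hT haT)).1) (not_le.2 hba)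
          · exact h2 a haT b hb hba

/-- Whether `insert x B` satisfies `P`, for a `d`-subset `B` of `T` and `x ∈ W` lying after all of
`B`, does not depend on `x`. -/
def EndHomogeneous {α β : Type*} [DecidableEq α] [LinearOrder β] (key : α → β)
    (P : Finset α → Prop) (d : ℕ) (T W : Finset α) : Prop :=
  ∀ B ⊆ T, B.card = d → ∀ x ∈ W, ∀ y ∈ W, (∀ b ∈ B, key b < key x) → (∀ b ∈ B, key b < key y) →
    (P (insert x B) ↔ P (insert y B))

lemma EndHomogeneous.exists_extension {α β : Type*} [DecidableEq α] [LinearOrder β]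
    {key : α → β} (hkey : Function.Injective key) {P : Finset α → Prop} {d N : ℕ} (m : ℕ)
    {T S : Finset α} (hN : T.card + m ≤ N) (hTS : ∀ t ∈ T, ∀ s ∈ S, key t < key s)
    (hH : EndHomogeneous key P (d + 1) T (T ∪ S)) (hS : (2 * 2 ^ N ^ d) ^ m ≤ S.card) :
    ∃ U ⊆ T ∪ S, U.card = T.card + m ∧ EndHomogeneous key P (d + 1) U U := by
  classical
  induction m generalizing T S with
  | zero =>
    exact ⟨T, Finset.subset_union_left, rfl, fun B hB hc x hx y hy =>
      hH B hB hc x (Finset.mem_union_left _ hx) y (Finset.mem_union_left _ hy)⟩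
  | succ m ih =>
    have hpos : 0 < (2 * 2 ^ N ^ d) ^ m := by positivity
    have hne : S.Nonempty := by
      rw [← Finset.card_pos]; exact lt_of_lt_of_le (by positivity) hS
    obtain ⟨v, hv, hmin⟩ := Finset.exists_min_image S key hne
    have hlt : ∀ s ∈ S.erase v, key v < key s := fun s hs =>
      lt_of_le_of_ne (hmin s (Finset.mem_of_mem_erase hs))
        fun h => (Finset.ne_of_mem_erase hs) (hkey h).symm
    have hvT : v ∉ T := fun h => lt_irrefl _ (hTS v h v hv)
    let f : α → Finset (Finset α) := fun x =>
      (T.powersetCard d).filter fun B => P (insert x (insert v B))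
    have hcard : (T.powersetCard d).powerset.card * (2 * 2 ^ N ^ d) ^ m ≤ (S.erase v).card := by
      rw [Finset.card_powerset, Finset.card_powersetCard, Finset.card_erase_of_mem hv]
      have h1 : T.card.choose d ≤ N ^ d :=
        (Nat.choose_le_pow _ _).trans (Nat.pow_le_pow_left (by omega) _)
      have h2 : 2 ^ T.card.choose d ≤ 2 ^ N ^ d := Nat.pow_le_pow_right (by norm_num) h1
      have h3 : 0 < 2 ^ N ^ d := by positivity
      have h4 := Nat.mul_le_mul_right ((2 * 2 ^ N ^ d) ^ m) h2
      have h5 : 0 < 2 ^ N ^ d * (2 * 2 ^ N ^ d) ^ m := by positivity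
      rw [pow_succ] at hS
      have h6 : (2 * 2 ^ N ^ d) ^ m * (2 * 2 ^ N ^ d) =
        2 * (2 ^ N ^ d * (2 * 2 ^ N ^ d) ^ m) := by ring
      omega
    obtain ⟨c, -, hc⟩ := Finset.exists_le_card_fiber_of_mul_le_card_of_maps_to
      (f := f) (fun x _ => Finset.mem_powerset.2 (Finset.filter_subset _ _))
      ⟨∅, by simp⟩ hcard
    set S' := (S.erase v).filter fun x => f x = c with hS'
    have hS'S : S' ⊆ S.erase v := Finset.filter_subset _ _
    have hsub : insert v T ∪ S' ⊆ T ∪ S := by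
      intro x hx
      rcases Finset.mem_union.1 hx with hx | hx
      · rcases Finset.mem_insert.1 hx with rfl | hx
        exacts [Finset.mem_union_right _ hv, Finset.mem_union_left _ hx]
      · exact Finset.mem_union_right _ (Finset.mem_of_mem_erase (hS'S hx))
    have hTc : (insert v T).card = T.card + 1 := Finset.card_insert_of_notMem hvT
    have hafter : ∀ x ∈ insert v T ∪ S', key v < key x → x ∈ S' := by
      intro x hx hvx
      rcases Finset.mem_union.1 hx with hx | hx
      · rcases Finset.mem_insert.1 hx with rfl | hx
        · exact absurd hvx (lt_irrefl _)
        · exact absurd hvx (lt_asymm (hTS x hx v hv))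
      · exact hx
    obtain ⟨U, hU, hUc, hUH⟩ := ih (T := insert v T) (S := S') (by omega) (by
      intro t ht s hs
      rcases Finset.mem_insert.1 ht with rfl | ht
      · exact hlt s (hS'S hs)
      · exact hTS t ht s (Finset.mem_of_mem_erase (hS'S hs))) (by
      intro B hB hBc x hx y hy hxB hyB
      by_cases hvB : v ∈ B
      · have hx' := hafter x hx (hxB v hvB)
        have hy' := hafter y hy (hyB v hvB)
        have hBT : B.erase v ∈ T.powersetCard d := by
          rw [Finset.mem_powersetCard, Finset.card_erase_of_mem hvB, hBc]
          refine ⟨fun b hb => ?_, rfl⟩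
          exact (Finset.mem_insert.1 (hB (Finset.mem_of_mem_erase hb))).resolve_left
            (Finset.ne_of_mem_erase hb)
        have hfx : f x = f y :=
          (Finset.mem_filter.1 hx').2.trans (Finset.mem_filter.1 hy').2.symm
        have := Finset.ext_iff.1 hfx (B.erase v)
        simpa only [f, Finset.mem_filter, hBT, true_and, Finset.insert_erase hvB] using this
      · have hBT : B ⊆ T := fun b hb => (Finset.mem_insert.1 (hB hb)).resolve_left
          (fun h => hvB (h ▸ hb))
        exact hH B hBT hBc x (hsub hx) y (hsub hy) hxB hyB) hc
    exact ⟨U, hU.trans hsub, by omega, hUH⟩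

/-- One Erdős–Rado step: passing to a logarithmically smaller set `T` and an endpoint `m`, the
`(k + 1)`-sets in `T ∪ {m}` satisfy `P` according to their initial segments of size `k`. -/
lemma exists_endpoint_reduction {α β : Type*} [DecidableEq α] [LinearOrder β]
    {key : α → β} (hkey : Function.Injective key) (P : Finset α → Prop) {k M : ℕ} (hk : 2 ≤ k)
    (hM : 1 ≤ M) {S : Finset α} (hS : 2 ^ (M + 1) ^ (k + 1) ≤ S.card) :
    ∃ m ∈ S, ∃ T ⊆ S, T.card = M ∧ (∀ t ∈ T, key t < key m) ∧
      ∀ B ⊆ T, B.card = k → ∀ a ∈ T, (∀ b ∈ B, key b < key a) →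
        (P (insert a B) ↔ P (insert m B)) := by
  obtain ⟨d, rfl⟩ : ∃ d, k = d + 1 := ⟨k - 1, by omega⟩
  have hle : (2 * 2 ^ (M + 1) ^ d) ^ (M + 1) ≤ S.card := by
    refine le_trans ?_ hS
    rw [← pow_succ', ← pow_mul]
    apply Nat.pow_le_pow_right (by norm_num)
    have h1 : 1 ≤ (M + 1) ^ d := Nat.one_le_pow _ _ (by omega)
    have h2 : (M + 1) ^ (d + 1 + 1) = (M + 1) ^ d * (M + 1) * (M + 1) := by ring
    rw [h2]
    apply Nat.mul_le_mul_right
    nlinarith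
  obtain ⟨U, hU, hUc, hUH⟩ := EndHomogeneous.exists_extension hkey (P := P) (d := d)
    (N := M + 1) (M + 1) (T := ∅) (S := S) (by simp) (by simp)
    (fun B hB hBc => by rw [Finset.subset_empty.1 hB] at hBc; simp at hBc) hle
  rw [Finset.empty_union] at hU
  rw [Finset.card_empty, zero_add] at hUc
  obtain ⟨m, hm, hmax⟩ := Finset.exists_max_image U key
    (by rw [← Finset.card_pos]; omega)
  have hlt : ∀ t ∈ U.erase m, key t < key m := fun t ht =>
    lt_of_le_of_ne (hmax t (Finset.mem_of_mem_erase ht))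
      fun h => Finset.ne_of_mem_erase ht (hkey h)
  refine ⟨m, hU hm, U.erase m, (Finset.erase_subset _ _).trans hU, ?_, hlt, ?_⟩
  · rw [Finset.card_erase_of_mem hm]; omega
  · intro B hB hBc a ha hBa
    exact hUH B (hB.trans (Finset.erase_subset _ _)) hBc a (Finset.mem_of_mem_erase ha) m hm hBa
      fun b hb => hlt b (hB hb)

/-- All `k`-subsets of `T` satisfy `P`, or none does. -/
def IsHomogeneous {α : Type*} (P : Finset α → Prop) (k : ℕ) (T : Finset α) : Prop :=
  (∀ e ⊆ T, e.card = k → P e) ∨ ∀ e ⊆ T, e.card = k → ¬ P e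

lemma IsHomogeneous.of_endpoint {α β : Type*} [DecidableEq α] [LinearOrder β]
    {key : α → β} (hkey : Function.Injective key) {P : Finset α → Prop} {k : ℕ} {m : α}
    {T U : Finset α}
    (h : ∀ B ⊆ T, B.card = k → ∀ a ∈ T, (∀ b ∈ B, key b < key a) →
      (P (insert a B) ↔ P (insert m B)))
    (hUT : U ⊆ T) (hU : IsHomogeneous (fun B => P (insert m B)) k U) :
    IsHomogeneous P (k + 1) U := by
  have key' : ∀ e ⊆ U, e.card = k + 1 → ∃ B ⊆ U, B.card = k ∧ (P e ↔ P (insert m B)) := by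
    intro e he hc
    obtain ⟨a, ha, hmax⟩ := Finset.exists_max_image e key (by rw [← Finset.card_pos]; omega)
    have hB : e.erase a ⊆ U := (Finset.erase_subset _ _).trans he
    have hBc : (e.erase a).card = k := by rw [Finset.card_erase_of_mem ha]; omega
    refine ⟨e.erase a, hB, hBc, ?_⟩
    rw [← h _ (hB.trans hUT) hBc a (hUT (he ha)), Finset.insert_erase ha]
    exact fun b hb => lt_of_le_of_ne (hmax b (Finset.mem_of_mem_erase hb))
      fun h => Finset.ne_of_mem_erase hb (hkey h)
  refine hU.imp ?_ ?_
  all_goals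
    intro hP e he hc
    obtain ⟨B, hB, hBc, hiff⟩ := key' e he hc
    rw [hiff]
    exact hP B hB hBc

open Classical in
/-- For every `(k + 1)`-subset of `S` whose initial segment of size `k` fails `P`, the number of its
other `k`-subsets satisfying `P` is not `j`. -/
def AvoidsCount {α : Type*} [LinearOrder α] (P : Finset α → Prop) (k j : ℕ) (S : Finset α) :
    Prop :=
  ∀ B ⊆ S, B.card = k → ∀ x ∈ S, (∀ b ∈ B, b < x) → ¬ P B →
    (B.filter fun b => P (insert x (B.erase b))).card ≠ j

lemma AvoidsCount.of_endpoint {α : Type*} [LinearOrder α] {P : Finset α → Prop} {k j : ℕ}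
    {S T : Finset α} {m : α} (hS : AvoidsCount P (k + 1) j S) (hm : m ∈ S) (hTS : T ⊆ S)
    (hTm : ∀ t ∈ T, t < m)
    (h : ∀ B ⊆ T, B.card = k → ∀ a ∈ T, (∀ b ∈ B, b < a) → (P (insert a B) ↔ P (insert m B))) :
    AvoidsCount (fun B => P (insert m B)) k j T := by
  classical
  intro B hB hBc x hx hBx hP hcount
  have hxB : x ∉ B := fun hx' => lt_irrefl _ (hBx x hx')
  have hins : insert x B ⊆ T := Finset.insert_subset hx hB
  refine hS (insert x B) (hins.trans hTS) (by rw [Finset.card_insert_of_notMem hxB, hBc]) m hm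
    (fun b hb => hTm b (hins hb)) (by rwa [h B hB hBc x hx hBx]) ?_
  rw [← hcount]
  congr 1
  rw [Finset.filter_insert, Finset.erase_insert hxB, if_neg hP]
  ext b
  simp only [Finset.mem_filter]
  refine and_congr_right fun hb => ?_
  rw [Finset.erase_insert_of_ne (ne_of_mem_of_not_mem hb hxB).symm]

lemma avoidsCount_self_iff {α : Type*} [LinearOrder α] {P : Finset α → Prop} {k : ℕ}
    {S : Finset α} : AvoidsCount P k k S ↔ ∀ B ⊆ S, B.card = k → ∀ x ∈ S, (∀ b ∈ B, b < x) →
      (∀ b ∈ B, P (insert x (B.erase b))) → P B := by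
  classical
  refine forall_congr' fun B => forall_congr' fun _ => forall_congr' fun hc => forall_congr'
    fun x => forall_congr' fun _ => forall_congr' fun _ => ?_
  subst hc
  rw [Ne, not_imp_not]
  refine imp_congr_left ?_
  rw [Finset.card_filter_eq_iff]

lemma AvoidsCount.of_initial_endpoint {α : Type*} [LinearOrder α] {P : Finset α → Prop} {k : ℕ}
    (hk : 1 ≤ k) {S T : Finset α} {m : α} (hS : AvoidsCount P (k + 1) (k + 1) S) (hm : m ∈ S)
    (hTS : T ⊆ S) (hTm : ∀ t ∈ T, m < t)
    (h : ∀ B ⊆ T, B.card = k → ∀ a ∈ T, (∀ b ∈ B, a < b) → (P (insert a B) ↔ P (insert m B))) :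
    AvoidsCount (fun B => P (insert m B)) k k T := by
  rw [avoidsCount_self_iff] at hS ⊢
  intro B hB hBc x hx hBx hP
  have hmB : m ∉ B := fun hm' => lt_irrefl _ (hTm m (hB hm'))
  have hxB : x ∉ B := fun hx' => lt_irrefl _ (hBx x hx')
  refine hS (insert m B) (Finset.insert_subset hm (hB.trans hTS))
    (by rw [Finset.card_insert_of_notMem hmB, hBc]) x (hTS hx) ?_ ?_
  · intro b hb
    rcases Finset.mem_insert.1 hb with rfl | hb
    exacts [hTm x hx, hBx b hb]
  · intro b hb
    rcases Finset.mem_insert.1 hb with rfl | hb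
    · rw [Finset.erase_insert hmB]
      have hne : B.Nonempty := by rw [← Finset.card_pos]; omega
      obtain ⟨a, ha, hmin⟩ := Finset.exists_min_image B id hne
      have hC : insert x (B.erase a) ⊆ T :=
        Finset.insert_subset hx ((Finset.erase_subset _ _).trans hB)
      have hCc : (insert x (B.erase a)).card = k := by
        rw [Finset.card_insert_of_notMem fun h => hxB (Finset.mem_of_mem_erase h),
          Finset.card_erase_of_mem ha]
        omega
      have := (h _ hC hCc a (hB ha) (by
        intro c hc
        rcases Finset.mem_insert.1 hc with rfl | hc
        · exact hBx a ha
        · exact lt_of_le_of_ne (hmin c (Finset.mem_of_mem_erase hc))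
            (Finset.ne_of_mem_erase hc).symm)).2 (hP a ha)
      rwa [Finset.insert_comm, Finset.insert_erase ha] at this
    · rw [Finset.erase_insert_of_ne (ne_of_mem_of_not_mem hb hmB).symm, Finset.insert_comm]
      exact hP b hb

/-- A pair predicate holds on all `2`-subsets if it holds on all increasing pairs. -/
lemma forall_card_two_of_lt {α : Type*} [LinearOrder α] {P : Finset α → Prop} {T : Finset α}
    (h : ∀ a ∈ T, ∀ b ∈ T, a < b → P {a, b}) : ∀ e ⊆ T, e.card = 2 → P e := by
  intro e he hc
  obtain ⟨a, b, hab, rfl⟩ := Finset.card_eq_two.1 hc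
  have ha : a ∈ T := he (by simp)
  have hb : b ∈ T := he (by simp)
  rcases lt_or_gt_of_ne hab with hlt | hlt
  · exact h a ha b hb hlt
  · rw [Finset.pair_comm]; exact h b hb a ha hlt

lemma AvoidsCount.exists_isHomogeneous_two {α : Type*} [LinearOrder α] {P : Finset α → Prop}
    {j s : ℕ} (hj : j ≤ 2) (hs : 1 ≤ s) {S : Finset α} (hS : s ^ 2 ≤ S.card)
    (hP : AvoidsCount P 2 j S) : ∃ T ⊆ S, s ≤ T.card ∧ IsHomogeneous P 2 T := by
  classical
  have htriple : ∀ a ∈ S, ∀ b ∈ S, ∀ x ∈ S, a < b → b < x → ¬ P {a, b} →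
      (if P {b, x} then 1 else 0) + (if P {a, x} then 1 else 0) ≠ j := by
    intro a ha b hb x hx hab hbx hn hsum
    refine hP {a, b} (Finset.insert_subset ha (Finset.singleton_subset_iff.2 hb))
      (Finset.card_pair hab.ne) x hx ?_ hn ?_
    · intro c hc
      rcases Finset.mem_insert.1 hc with rfl | hc
      · exact hab.trans hbx
      · rwa [Finset.mem_singleton.1 hc]
    · have h1 : ({a, b} : Finset α).erase a = {b} := by
        rw [Finset.erase_insert (by simpa using hab.ne)]
      have h2 : ({a, b} : Finset α).erase b = {a} := by
        rw [Finset.pair_comm, Finset.erase_insert (by simpa using hab.ne')]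
      rw [Finset.card_filter, Finset.sum_pair hab.ne, h1, h2, Finset.pair_comm x b,
        Finset.pair_comm x a, hsum]
  rw [sq] at hS
  interval_cases j
  · rcases exists_large_backNbhd_or_indep id (fun e => ¬ P e) hs s S hS with
      ⟨x, hx, T, hT, hc, h⟩ | ⟨T, hT, hc, h⟩
    · refine ⟨T, hT, hc, Or.inl (forall_card_two_of_lt fun a ha b hb hab => ?_)⟩
      by_contra hn
      have := htriple a (hT ha) b (hT hb) x hx hab (h b hb).1 hn
      simp [(h a ha).2, (h b hb).2] at this
    · exact ⟨T, hT, hc, Or.inl (forall_card_two_of_lt fun a ha b hb hab =>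
        not_not.1 (h b hb a ha hab))⟩
  · rcases exists_large_backNbhd_or_indep OrderDual.toDual
      (fun e => ¬ P e) hs s S hS with ⟨x, hx, T, hT, hc, h⟩ | ⟨T, hT, hc, h⟩
    · refine ⟨T, hT, hc, Or.inr (forall_card_two_of_lt fun a ha b hb hab => ?_)⟩
      intro hn
      have hxa := h a ha
      have hxb := h b hb
      rw [OrderDual.toDual_lt_toDual, Finset.pair_comm] at hxa hxb
      have := htriple x hx a (hT ha) b (hT hb) hxa.1 hab hxa.2
      simp [hn, hxb.2] at this
    · refine ⟨T, hT, hc, Or.inl (forall_card_two_of_lt fun a ha b hb hab => ?_)⟩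
      have := h a ha b hb (OrderDual.toDual_lt_toDual.2 hab)
      rwa [not_not, Finset.pair_comm] at this
  · rcases exists_large_backNbhd_or_indep id P hs s S hS with
      ⟨x, hx, T, hT, hc, h⟩ | ⟨T, hT, hc, h⟩
    · refine ⟨T, hT, hc, Or.inl (forall_card_two_of_lt fun a ha b hb hab => ?_)⟩
      by_contra hn
      have := htriple a (hT ha) b (hT hb) x hx hab (h b hb).1 hn
      simp [(h a ha).2, (h b hb).2] at this
    · exact ⟨T, hT, hc, Or.inr (forall_card_two_of_lt fun a ha b hb hab => h b hb a ha hab)⟩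

/-- A size that forces a homogeneous set of size `s` for `(i + 2)`-sets. -/
def homogeneousBound (s : ℕ) : ℕ → ℕ
  | 0 => s ^ 2
  | i + 1 => 2 ^ (homogeneousBound s i + 1) ^ (i + 3)

lemma AvoidsCount.exists_isHomogeneous {α : Type*} [LinearOrder α] {s : ℕ} (hs : 1 ≤ s) (i : ℕ)
    {P : Finset α → Prop} {j : ℕ} (hj : j ≤ i + 2) {S : Finset α}
    (hS : homogeneousBound s i ≤ S.card) (hP : AvoidsCount P (i + 2) j S) :
    ∃ T ⊆ S, s ≤ T.card ∧ IsHomogeneous P (i + 2) T := by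
  induction i generalizing P j S with
  | zero => exact hP.exists_isHomogeneous_two hj hs hS
  | succ i ih =>
    have hpos : 1 ≤ homogeneousBound s i := by
      cases i <;> exact Nat.one_le_pow _ _ (by omega)
    rcases hj.lt_or_eq with hj | rfl
    · obtain ⟨m, hm, T, hT, hTc, hTm, h⟩ := exists_endpoint_reduction (k := i + 2)
        Function.injective_id P (by omega) hpos hS
      obtain ⟨U, hU, hUc, hUH⟩ := ih (by omega) hTc.ge (hP.of_endpoint hm hT hTm h)
      exact ⟨U, hU.trans hT, hUc, hUH.of_endpoint Function.injective_id h hU⟩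
    · obtain ⟨m, hm, T, hT, hTc, hTm, h⟩ := exists_endpoint_reduction (k := i + 2)
        OrderDual.toDual.injective P (by omega) hpos hS
      obtain ⟨U, hU, hUc, hUH⟩ := ih le_rfl hTc.ge
        (hP.of_initial_endpoint (by omega) hm hT hTm h)
      exact ⟨U, hU.trans hT, hUc, hUH.of_endpoint OrderDual.toDual.injective h hU⟩

/-- The tower function: `towerOfTwos 0 x = x` and `towerOfTwos (i + 1) x = 2 ^ towerOfTwos i x`. -/
def towerOfTwos : ℕ → ℕ → ℕ
  | 0, x => x
  | i + 1, x => 2 ^ towerOfTwos i x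

lemma one_le_towerOfTwos (i : ℕ) {x : ℕ} (hx : 1 ≤ x) : 1 ≤ towerOfTwos i x := by
  cases i
  exacts [hx, Nat.one_le_two_pow]

lemma mul_towerOfTwos_le {M x : ℕ} (hM : 1 ≤ M) (hx : 1 ≤ x) (i : ℕ) :
    M * towerOfTwos i x ≤ towerOfTwos i (M * x) := by
  induction i with
  | zero => exact le_rfl
  | succ i ih =>
    refine le_trans ?_ (Nat.pow_le_pow_right (by norm_num) ih)
    obtain ⟨L, rfl⟩ : ∃ L, M = L + 1 := ⟨M - 1, by omega⟩
    have h1 : L + 1 ≤ 2 ^ L := Nat.lt_two_pow_self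
    have h2 := one_le_towerOfTwos i hx
    calc (L + 1) * 2 ^ towerOfTwos i x ≤ 2 ^ L * 2 ^ towerOfTwos i x :=
          Nat.mul_le_mul_right _ h1
      _ = 2 ^ (L + towerOfTwos i x) := (pow_add _ _ _).symm
      _ ≤ 2 ^ ((L + 1) * towerOfTwos i x) := Nat.pow_le_pow_right (by norm_num) (by nlinarith)

lemma exists_homogeneousBound_le (i : ℕ) : ∃ A : ℕ, 1 ≤ A ∧ ∀ s : ℕ, 1 ≤ s →
    homogeneousBound s (i + 1) ≤ towerOfTwos (i + 1) (A * s ^ 6) := by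
  induction i with
  | zero =>
    refine ⟨8, by norm_num, fun s hs => Nat.pow_le_pow_right (by norm_num) ?_⟩
    have h1 : 1 ≤ s ^ 2 := Nat.one_le_pow _ _ hs
    calc (s ^ 2 + 1) ^ 3 ≤ (2 * s ^ 2) ^ 3 := Nat.pow_le_pow_left (by omega) _
      _ = 8 * s ^ 6 := by ring
  | succ i ih =>
    obtain ⟨A, hA, h⟩ := ih
    refine ⟨(2 * (i + 4)) * A, by nlinarith, fun s hs =>
      Nat.pow_le_pow_right (by norm_num) ?_⟩
    have hx : 1 ≤ A * s ^ 6 := Nat.one_le_iff_ne_zero.2 (by positivity)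
    have h1 := one_le_towerOfTwos i hx
    calc (homogeneousBound s (i + 1) + 1) ^ (i + 1 + 3)
        ≤ (2 * towerOfTwos (i + 1) (A * s ^ 6)) ^ (i + 4) := by
          refine Nat.pow_le_pow_left ?_ _
          have := h s hs
          have := one_le_towerOfTwos (i + 1) hx
          omega
      _ = 2 ^ ((towerOfTwos i (A * s ^ 6) + 1) * (i + 4)) := by
          rw [pow_mul, pow_succ' 2 (towerOfTwos _ _)]; rfl
      _ ≤ 2 ^ (2 * (i + 4) * towerOfTwos i (A * s ^ 6)) :=
          Nat.pow_le_pow_right (by norm_num) (by nlinarith)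
      _ ≤ 2 ^ towerOfTwos i (2 * (i + 4) * (A * s ^ 6)) :=
          Nat.pow_le_pow_right (by norm_num) (mul_towerOfTwos_le (by omega) hx i)
      _ = towerOfTwos (i + 1) (2 * (i + 4) * A * s ^ 6) := by
          rw [← mul_assoc]; rfl

lemma tendsto_iterLog_s1 (i : ℕ) : Filter.Tendsto (iterLog i) Filter.atTop Filter.atTop := by
  induction i with
  | zero => exact Filter.tendsto_id
  | succ i ih => exact (Real.tendsto_logb_atTop (by norm_num)).comp ih

lemma towerOfTwos_le_of_le_iterLog {x : ℝ} (i : ℕ) (hpos : ∀ l ≤ i, 0 < iterLog l x) {y : ℕ}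
    (hy : (y : ℝ) ≤ iterLog i x) : (towerOfTwos i y : ℝ) ≤ x := by
  suffices h : ∀ l ≤ i, (towerOfTwos l y : ℝ) ≤ iterLog (i - l) x by
    simpa [iterLog] using h i le_rfl
  intro l
  induction l with
  | zero => exact fun _ => hy
  | succ l ih =>
    intro hl
    have h := ih (by omega)
    rw [show i - l = i - (l + 1) + 1 by omega, iterLog,
      Real.le_logb_iff_rpow_le (by norm_num) (hpos _ (by omega)), Real.rpow_natCast] at h
    simpa [towerOfTwos] using h

/-- For an `r`-graph, forbidding `(r + 1, f)`-subsets bounds the counts in the sense of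
`AvoidsCount`. -/
lemma avoidsCount_of_not_hasMFSubset {n r f : ℕ} {E : Finset (Finset (Fin n))}
    (hE : ∀ e ∈ E, e.card = r) (h : ¬ HasMFSubset E (r + 1) f) (S : Finset (Fin n)) :
    AvoidsCount (· ∈ E) r f S := by
  classical
  intro B _ hBc x _ hBx hBE hcount
  have hxB : x ∉ B := fun hx => lt_irrefl _ (hBx x hx)
  refine h ⟨insert x B, by rw [Finset.card_insert_of_notMem hxB, hBc], ?_⟩
  have himage : E.filter (fun e => e ⊆ insert x B) =
      (B.filter fun b => insert x (B.erase b) ∈ E).image fun b => (insert x B).erase b := by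
    ext e
    simp only [Finset.mem_filter, Finset.mem_image]
    constructor
    · rintro ⟨he, hsub⟩
      have hc : (insert x B \ e).card = 1 := by
        rw [Finset.card_sdiff_of_subset hsub, Finset.card_insert_of_notMem hxB, hE e he, hBc]
        omega
      obtain ⟨b, hb⟩ := Finset.card_eq_one.1 hc
      have heq : (insert x B).erase b = e := by
        rw [Finset.erase_eq, ← hb, Finset.sdiff_sdiff_eq_self hsub]
      have hbx : x ≠ b := by
        rintro rfl
        rw [Finset.erase_insert hxB] at heq
        exact hBE (heq ▸ he)
      have hbB : b ∈ B := by
        have : b ∈ insert x B \ e := by simp [hb]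
        exact (Finset.mem_insert.1 (Finset.mem_sdiff.1 this).1).resolve_left hbx.symm
      exact ⟨b, ⟨hbB, by rwa [← Finset.erase_insert_of_ne hbx, heq]⟩, heq⟩
    · rintro ⟨b, ⟨hb, hbE⟩, rfl⟩
      rw [Finset.erase_insert_of_ne (ne_of_mem_of_not_mem hb hxB).symm]
      exact ⟨hbE, Finset.insert_subset_insert _ (Finset.erase_subset _ _)⟩
  rw [himage, Finset.card_image_of_injOn]
  · convert hcount
  exact (Finset.erase_injOn _).mono fun b hb =>
    Finset.mem_insert_of_mem (Finset.mem_filter.1 hb).1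

lemma avoidsCount_compl_of_not_hasMFSubset {n r : ℕ} {E : Finset (Finset (Fin n))}
    (hE : ∀ e ∈ E, e.card = r) (h : ¬ HasMFSubset E (r + 1) (r + 1)) (S : Finset (Fin n)) :
    AvoidsCount (· ∉ E) r 0 S := by
  classical
  intro B _ hBc x _ hBx hBE hcount
  have hxB : x ∉ B := fun hx => lt_irrefl _ (hBx x hx)
  have hAc : (insert x B).card = r + 1 := by rw [Finset.card_insert_of_notMem hxB, hBc]
  refine h ⟨insert x B, hAc, ?_⟩
  have hall : E.filter (fun e => e ⊆ insert x B) = (insert x B).powersetCard r := by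
    ext e
    rw [Finset.mem_filter, Finset.mem_powersetCard]
    refine ⟨fun he => ⟨he.2, hE e he.1⟩, fun he => ⟨?_, he.1⟩⟩
    by_cases hx : x ∈ e
    · have hsub : e.erase x ⊆ B := fun b hb =>
        (Finset.mem_insert.1 (he.1 (Finset.mem_of_mem_erase hb))).resolve_left
          (Finset.ne_of_mem_erase hb)
      have hc : (B \ e.erase x).card = 1 := by
        have := Finset.card_pos.2 ⟨x, hx⟩
        rw [Finset.card_sdiff_of_subset hsub, Finset.card_erase_of_mem hx, he.2, hBc]
        omega
      obtain ⟨b, hb⟩ := Finset.card_eq_one.1 hc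
      have hbB : b ∈ B := by
        have : b ∈ B \ e.erase x := by simp [hb]
        exact (Finset.mem_sdiff.1 this).1
      have hins : insert x (B.erase b) = e := by
        rw [Finset.erase_eq, ← hb, Finset.sdiff_sdiff_eq_self hsub, Finset.insert_erase hx]
      by_contra heE
      rw [Finset.card_eq_zero, Finset.eq_empty_iff_forall_notMem] at hcount
      exact hcount b ((@Finset.mem_filter _ _ (_) _ _).2 ⟨hbB, by rwa [hins]⟩)
    · have hsub : e ⊆ B := fun b hb =>
        (Finset.mem_insert.1 (he.1 hb)).resolve_left fun hbx => hx (hbx ▸ hb)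
      rw [Finset.eq_of_subset_of_card_le hsub (by rw [he.2, hBc])]
      exact not_not.1 hBE
  rw [hall, Finset.card_powersetCard, hAc, Nat.choose_succ_self_right]

lemma exists_clique_or_indep_of_homogeneousBound_le {n r f s : ℕ} (hs : 1 ≤ s) (hr : 2 ≤ r)
    (hf : f ≤ r + 1) {E : Finset (Finset (Fin n))} (hE : ∀ e ∈ E, e.card = r)
    (h : ¬ HasMFSubset E (r + 1) f) (hn : homogeneousBound s (r - 2) ≤ n) :
    ∃ S : Finset (Fin n), s ≤ S.card ∧ (IsRClique r E S ∨ IsRIndep r E S) := by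
  obtain ⟨i, rfl⟩ : ∃ i, r = i + 2 := ⟨r - 2, by omega⟩
  have hn' : homogeneousBound s i ≤ (Finset.univ : Finset (Fin n)).card := by simpa using hn
  rcases hf.lt_or_eq with hf | rfl
  · obtain ⟨S, -, hc, hS⟩ := (avoidsCount_of_not_hasMFSubset hE h Finset.univ).exists_isHomogeneous
      hs i (by omega) hn'
    exact ⟨S, hc, hS⟩
  · obtain ⟨S, -, hc, hS⟩ :=
      (avoidsCount_compl_of_not_hasMFSubset hE h Finset.univ).exists_isHomogeneous
        hs i (by omega) hn'
    exact ⟨S, hc, hS.symm.imp (fun h e he hc => not_not.1 (h e he hc)) id⟩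

theorem stmt1 :
    ∃ c : ℝ, 0 < c ∧
      ∀ r : ℕ, 3 ≤ r →
        ∃ C : ℝ, 0 < C ∧
          ∀ f : ℕ, f ≤ r + 1 →
            ∃ n₀ : ℕ, ∀ n : ℕ, n₀ ≤ n →
              ∀ E : Finset (Finset (Fin n)), (∀ e ∈ E, e.card = r) →
                ¬ HasMFSubset E (r + 1) f →
                ∃ S : Finset (Fin n),
                  C * iterLog (r - 2) (n : ℝ) ^ c ≤ (S.card : ℝ) ∧
                  (IsRClique r E S ∨ IsRIndep r E S) := by
  refine ⟨1 / 6, by norm_num, fun r hr => ?_⟩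
  obtain ⟨A, hA, hbound⟩ := exists_homogeneousBound_le (r - 3)
  rw [show r - 3 + 1 = r - 2 by omega] at hbound
  have hA' : (1 : ℝ) ≤ A := by exact_mod_cast hA
  refine ⟨(1 / A : ℝ) ^ (1 / 6 : ℝ) / 2, by positivity, fun f hf => ?_⟩
  have hev : ∀ᶠ n : ℕ in Filter.atTop,
      (∀ l ∈ Finset.range (r - 1), 0 < iterLog l (n : ℝ)) ∧ (A : ℝ) ≤ iterLog (r - 2) n := by
    refine Filter.Eventually.and ?_ ?_
    · rw [Filter.eventually_all_finset]
      exact fun l _ =>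
        ((tendsto_iterLog_s1 l).comp tendsto_natCast_atTop_atTop).eventually_gt_atTop 0
    · exact ((tendsto_iterLog_s1 _).comp tendsto_natCast_atTop_atTop).eventually_ge_atTop _
  obtain ⟨n₀, hn₀⟩ := Filter.eventually_atTop.1 hev
  refine ⟨n₀, fun n hn E hE hfree => ?_⟩
  obtain ⟨hpos, hAx⟩ := hn₀ n hn
  set x := iterLog (r - 2) (n : ℝ) with hx
  set y : ℝ := (x / A) ^ (1 / 6 : ℝ) with hy
  have hA0 : (0 : ℝ) < A := by linarith
  have hxA : 1 ≤ x / A := by rwa [one_le_div hA0]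
  have hy1 : 1 ≤ y := Real.one_le_rpow hxA (by norm_num)
  have hs1 : 1 ≤ ⌊y⌋₊ := Nat.one_le_floor_iff _ |>.2 hy1
  have hy6 : y ^ 6 = x / A := by
    rw [hy, ← Real.rpow_natCast, ← Real.rpow_mul (by linarith)]
    norm_num
  have hle : ((A * ⌊y⌋₊ ^ 6 : ℕ) : ℝ) ≤ x := by
    push_cast
    calc (A : ℝ) * (⌊y⌋₊ : ℝ) ^ 6 ≤ A * y ^ 6 := by
          gcongr
          exact Nat.floor_le (by linarith)
      _ = x := by rw [hy6]; field_simp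
  have htower : towerOfTwos (r - 2) (A * ⌊y⌋₊ ^ 6) ≤ n := by
    exact_mod_cast towerOfTwos_le_of_le_iterLog (r - 2)
      (fun l hl => hpos l (Finset.mem_range.2 (by omega))) hle
  obtain ⟨S, hSc, hS⟩ := exists_clique_or_indep_of_homogeneousBound_le hs1 (by omega) hf hE hfree
    ((hbound _ hs1).trans htower)
  refine ⟨S, ?_, hS⟩
  have h1 : (1 / A : ℝ) ^ (1 / 6 : ℝ) * x ^ (1 / 6 : ℝ) = y := by
    rw [← Real.mul_rpow (by positivity) (by linarith), hy]
    congr 1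
    ring
  have h2 := Nat.lt_floor_add_one y
  have h3 : (1 : ℝ) ≤ (⌊y⌋₊ : ℝ) := by exact_mod_cast hs1
  have h4 : ((⌊y⌋₊ : ℕ) : ℝ) ≤ S.card := by exact_mod_cast hSc
  calc (1 / A : ℝ) ^ (1 / 6 : ℝ) / 2 * x ^ (1 / 6 : ℝ) = y / 2 := by rw [← h1]; ring
    _ ≤ S.card := by linarith
end
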